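/- arXiv:1410.2453 — 3 statements merged into one kernel-verified Lean document; each statement's English description precedes it below -/
import Mathlib

section
/- Let {G_n}_{n≥1} be a sequence of uniformly nonamenable, transitive, locally finite, infinite connected graphs that converges locally to a transitive, locally finite, infinite connected graph G satisfying Assumption 1. Then for every ε > 0 and ε₁ > 0 there exists N ∈ ℕ such that p_c(G) ≤ p_c(G_n) + 2ε + ε₁ for all n ≥ N. -/
/-!
Statement 0 (He–Xiang–Zhu, Theorem 1): locality of the percolation critical
probability for uniformly nonamenable sequences of transitive graphs whose
local limit satisfies Assumption 1.
-/

open Filter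

namespace Loc

variable {V : Type*}

/-- `x` lies in the ball of radius `n` around `v` in `G` (graph distance via walks). -/
def inBall (G : SimpleGraph V) (v : V) (n : ℕ) (x : V) : Prop :=
  ∃ w : G.Walk v x, w.length ≤ n

/-- `x` lies on the sphere `∂B_G(u,n) = B_G(u,n) \ B_G(u,n-1)`. -/
def onSphere (G : SimpleGraph V) (u : V) (n : ℕ) (x : V) : Prop :=
  inBall G u n x ∧ ¬ inBall G u (n - 1) x

/-- `x` and `y` are joined by a walk of `G` all of whose edges lie in the finite set `S`
(the set of open edges). -/
def connectedVia (G : SimpleGraph V) (S : Finset (Sym2 V)) (x y : V) : Prop :=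
  ∃ w : G.Walk x y, ∀ e ∈ w.edges, e ∈ S

open Classical in
/-- The probability, under i.i.d. Bernoulli(`p`) bond percolation on the finite edge set `E`,
of the event `A`; a configuration is recorded as its (finite) set of open edges. -/
noncomputable def cylProb (p : ℝ) (E : Finset (Sym2 V)) (A : Finset (Sym2 V) → Prop) : ℝ :=
  ∑ S ∈ E.powerset, if A S then p ^ S.card * (1 - p) ^ (E.card - S.card) else 0

/-- The probability of an increasing event `A` (an event witnessed by finitely many open
edges) under Bernoulli(`p`) bond percolation: the supremum over finite edge sets of the
finite-volume probabilities. -/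
noncomputable def prob (p : ℝ) (A : Finset (Sym2 V) → Prop) : ℝ :=
  ⨆ E : Finset (Sym2 V), cylProb p E A

/-- `θ_G(p)` at the vertex `v`: the probability that `v` lies in an infinite open cluster,
i.e. the infimum over `n` of the probability that `v` is connected to the complement of
the ball of radius `n`. -/
noncomputable def theta (G : SimpleGraph V) (p : ℝ) (v : V) : ℝ :=
  ⨅ n : ℕ, prob p (fun S => ∃ x : V, ¬ inBall G v n x ∧ connectedVia G S v x)

/-- The critical probability of Bernoulli bond percolation on `G`:
`p_c(G) = inf {p ∈ [0,1] : ℙ_p(∃ infinite open cluster) > 0}`.  (For a countable graph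
there is an infinite cluster with positive probability iff `θ` is positive at some vertex.) -/
noncomputable def pc (G : SimpleGraph V) : ℝ :=
  sInf {p : ℝ | 0 ≤ p ∧ p ≤ 1 ∧ ∃ v : V, 0 < theta G p v}

/-- `b_n(x,u)`: the probability that `x` is connected to `u` by open edges inside the
ball `B_G(u,n)` under Bernoulli(`p`) bond percolation. -/
noncomputable def bconn (G : SimpleGraph V) (p : ℝ) (u : V) (n : ℕ) (x : V) : ℝ :=
  prob p (fun S => ∃ w : G.Walk u x, (∀ e ∈ w.edges, e ∈ S) ∧ ∀ y ∈ w.support, inBall G u n y)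

/-- `μ_n(x)`: the harmonic measure at `x ∈ ∂B_G(u,n)` of simple random walk on the
`d`-regular graph `G` started at `u`, i.e. `∑_γ d^{-|γ|}`, summed over all walks `γ`
from `u` to `x` whose vertices, except the last one, lie in `B_G(u,n-1)`. -/
noncomputable def harm (G : SimpleGraph V) (d : ℕ) (u : V) (n : ℕ) (x : V) : ℝ :=
  ∑' w : {w : G.Walk u x // ∀ y ∈ w.support.dropLast, inBall G u (n - 1) y},
    ((d : ℝ))⁻¹ ^ (w : G.Walk u x).length

/-- `λ₁(G)`: the bottom of the spectrum of `I - P` for simple random walk on `G`,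
computed in `ℓ²(V, deg)`; the infimum of the Rayleigh quotients of finitely supported
nonzero functions.  `G` is nonamenable iff `0 < lambda1 G`. -/
noncomputable def lambda1 (G : SimpleGraph V) : ℝ :=
  sInf {r : ℝ | ∃ f : V →₀ ℝ, f ≠ 0 ∧
    r = (∑ x ∈ f.support,
          (((G.neighborSet x).ncard : ℝ) * f x - ∑' y : G.neighborSet x, f (y : V)) * f x) /
        (∑ x ∈ f.support, ((G.neighborSet x).ncard : ℝ) * f x ^ 2)}

/-- `G` is vertex-transitive. -/
def IsTransitive (G : SimpleGraph V) : Prop :=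
  ∀ u v : V, ∃ φ : G ≃g G, φ u = v

/-- The balls `B_G(v,R)` and `B_H(w,R)` are isomorphic as rooted graphs. -/
def BallIso {W : Type*} (G : SimpleGraph V) (H : SimpleGraph W) (v : V) (w : W) (R : ℕ) :
    Prop :=
  ∃ φ : {x : V // inBall G v R x} ≃ {y : W // inBall H w R y},
    (φ ⟨v, ⟨SimpleGraph.Walk.nil, by simp⟩⟩).1 = w ∧
    ∀ a b : {x : V // inBall G v R x}, G.Adj a.1 b.1 ↔ H.Adj (φ a).1 (φ b).1

/-- The sequence of transitive graphs `G n` converges locally to the transitive graph `H`: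
for every radius `R` there is `N` such that for `n ≥ N` all `R`-balls of `G n` are
isomorphic, as rooted graphs, to the `R`-balls of `H`. -/
def ConvergesLocally {Vn : ℕ → Type*} {W : Type*} (G : ∀ n, SimpleGraph (Vn n))
    (H : SimpleGraph W) : Prop :=
  ∀ R : ℕ, ∃ N : ℕ, ∀ n, N ≤ n → ∀ (vn : Vn n) (w : W), BallIso (G n) H vn w R

/-- Assumption 1(i): the harmonic measures on the spheres `∂B_G(u,n)` are roughly uniform,
with constants independent of `u` and `n`. -/
def Assumption1i (G : SimpleGraph V) (d : ℕ) : Prop :=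
  ∃ c C : ℝ, 0 < c ∧ 0 < C ∧ ∀ (u : V) (n : ℕ), 1 ≤ n → ∀ x y : V,
    onSphere G u n x → onSphere G u n y →
      c * harm G d u n y ≤ harm G d u n x ∧ harm G d u n x ≤ C * harm G d u n y

/-- Assumption 1(ii): for every `p ∈ (p_c(G), 1)` the in-ball connection probabilities
`b_n(·,u)` on the spheres `∂B_G(u,n)` are roughly uniform, with constants depending only
on `p`. -/
def Assumption1ii (G : SimpleGraph V) : Prop :=
  ∀ p : ℝ, pc G < p → p < 1 →
    ∃ c₁ c₂ : ℝ, 0 < c₁ ∧ 0 < c₂ ∧ ∀ (u : V) (n : ℕ), 1 ≤ n → ∀ x y : V,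
      onSphere G u n x → onSphere G u n y →
        c₁ * bconn G p u n y ≤ bconn G p u n x ∧ bconn G p u n x ≤ c₂ * bconn G p u n y

section Expectation

variable {α β : Type*}

/-- The indicator of a proposition, as a real number. -/
noncomputable def ind (A : Prop) : ℝ :=
  open Classical in if A then 1 else 0

lemma ind_of {A : Prop} (h : A) : ind A = 1 := by simp [ind, h]

lemma ind_of_not {A : Prop} (h : ¬ A) : ind A = 0 := by simp [ind, h]

lemma ind_nonneg (A : Prop) : 0 ≤ ind A := by
  unfold ind; split_ifs <;> norm_num

lemma ind_le_one (A : Prop) : ind A ≤ 1 := by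
  unfold ind; split_ifs <;> norm_num

lemma ind_mono {A B : Prop} (h : A → B) : ind A ≤ ind B := by
  by_cases hA : A
  · rw [ind_of hA, ind_of (h hA)]
  · rw [ind_of_not hA]; exact ind_nonneg B

lemma ind_mul (A B : Prop) : ind A * ind B = ind (A ∧ B) := by
  by_cases hA : A <;> by_cases hB : B <;> simp [ind, hA, hB]

/-- A sum of indicators of mutually exclusive events, each contained in `B`, is at most the
indicator of `B`. -/
lemma sum_ind_le (s : Finset β) (A : β → Prop) (B : Prop)
    (huniq : ∀ a ∈ s, ∀ b ∈ s, A a → A b → a = b) (hB : ∀ a ∈ s, A a → B) :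
    ∑ a ∈ s, ind (A a) ≤ ind B := by
  by_cases h : ∃ a ∈ s, A a
  · obtain ⟨a, ha, hAa⟩ := h
    rw [Finset.sum_eq_single a, ind_of hAa, ind_of (hB a ha hAa)]
    · intro b hb hba
      exact ind_of_not fun hAb => hba (huniq b hb a ha hAb hAa)
    · exact fun hna => absurd ha hna
  · push Not at h
    rw [Finset.sum_eq_zero fun a ha => ind_of_not (h a ha)]
    exact ind_nonneg B

/-- The expectation of `f` under Bernoulli(`p`) percolation on the finite edge set `E`. -/
noncomputable def expect (p : ℝ) (E : Finset α) (f : Finset α → ℝ) : ℝ :=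
  ∑ S ∈ E.powerset, p ^ S.card * (1 - p) ^ (E.card - S.card) * f S

lemma cylProb_eq_expect {V : Type*} (p : ℝ) (E : Finset (Sym2 V)) (A : Finset (Sym2 V) → Prop) :
    cylProb p E A = expect p E fun S => ind (A S) := by
  unfold cylProb expect ind
  refine Finset.sum_congr rfl fun S _ => ?_
  by_cases h : A S <;> simp [h]

lemma expect_empty (p : ℝ) (f : Finset α → ℝ) : expect p ∅ f = f ∅ := by
  simp [expect]

lemma expect_congr {p : ℝ} {E : Finset α} {f g : Finset α → ℝ} (h : ∀ S ⊆ E, f S = g S) :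
    expect p E f = expect p E g :=
  Finset.sum_congr rfl fun S hS => by rw [h S (Finset.mem_powerset.1 hS)]

lemma expect_mono {p : ℝ} (hp0 : 0 ≤ p) (hp1 : p ≤ 1) {E : Finset α} {f g : Finset α → ℝ}
    (h : ∀ S ⊆ E, f S ≤ g S) : expect p E f ≤ expect p E g :=
  Finset.sum_le_sum fun S hS => mul_le_mul_of_nonneg_left (h S (Finset.mem_powerset.1 hS))
    (mul_nonneg (pow_nonneg hp0 _) (pow_nonneg (by linarith) _))

lemma expect_sub (p : ℝ) (E : Finset α) (f g : Finset α → ℝ) :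
    expect p E (fun S => f S - g S) = expect p E f - expect p E g := by
  simp only [expect, mul_sub, Finset.sum_sub_distrib]

lemma expect_const_mul (p c : ℝ) (E : Finset α) (f : Finset α → ℝ) :
    expect p E (fun S => c * f S) = c * expect p E f := by
  simp only [expect, Finset.mul_sum]
  exact Finset.sum_congr rfl fun S _ => by ring

lemma expect_sum (p : ℝ) (E : Finset α) (s : Finset β) (f : β → Finset α → ℝ) :
    expect p E (fun S => ∑ b ∈ s, f b S) = ∑ b ∈ s, expect p E (f b) := by
  simp only [expect, Finset.mul_sum]
  exact Finset.sum_comm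

lemma expect_insert [DecidableEq α] (p : ℝ) {a : α} {E : Finset α} (ha : a ∉ E) (f : Finset α → ℝ) :
    expect p (insert a E) f
      = p * expect p E (fun S => f (insert a S)) + (1 - p) * expect p E f := by
  unfold expect
  rw [Finset.sum_powerset_insert ha, add_comm, Finset.mul_sum, Finset.mul_sum]
  congr 1
  · refine Finset.sum_congr rfl fun S hS => ?_
    have haS : a ∉ S := fun h => ha (Finset.mem_powerset.1 hS h)
    rw [Finset.card_insert_of_notMem haS, Finset.card_insert_of_notMem ha,
      Nat.add_sub_add_right]
    ring
  · refine Finset.sum_congr rfl fun S hS => ?_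
    have hc := Finset.card_le_card (Finset.mem_powerset.1 hS)
    rw [Finset.card_insert_of_notMem ha, Nat.succ_sub hc, pow_succ]
    ring

lemma expect_const (p c : ℝ) (E : Finset α) : expect p E (fun _ => c) = c := by
  classical
  induction E using Finset.induction_on with
  | empty => simp [expect_empty]
  | insert a E ha ih => rw [expect_insert p ha, ih]; ring

lemma expect_union [DecidableEq α] (p : ℝ) {E F : Finset α} (h : Disjoint E F) (f : Finset α → ℝ) :
    expect p (E ∪ F) f = expect p E fun S => expect p F fun T => f (S ∪ T) := by
  induction E using Finset.induction_on generalizing f with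
  | empty => simp [expect_empty]
  | insert a E ha ih =>
    rw [Finset.disjoint_insert_left] at h
    have haEF : a ∉ E ∪ F := by simp [ha, h.1]
    rw [Finset.insert_union, expect_insert p haEF, expect_insert p ha, ih h.2, ih h.2]
    simp only [Finset.insert_union]

lemma expect_image [DecidableEq α] [DecidableEq β] (p : ℝ) {E : Finset α} {φ : α → β} (hφ : Set.InjOn φ E)
    (f : Finset β → ℝ) :
    expect p (E.image φ) f = expect p E fun S => f (S.image φ) := by
  induction E using Finset.induction_on generalizing f with
  | empty => simp [expect_empty]
  | insert a E ha ih =>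
    have hE : Set.InjOn φ E := hφ.mono (by simp)
    have hna : φ a ∉ E.image φ := by
      intro h
      obtain ⟨b, hb, hab⟩ := Finset.mem_image.1 h
      have : b = a := hφ (by simp [hb]) (by simp) hab
      exact ha (this ▸ hb)
    rw [Finset.image_insert, expect_insert p hna, expect_insert p ha, ih hE, ih hE]
    simp only [Finset.image_insert]

lemma expect_mono_param {p q : ℝ} (hp0 : 0 ≤ p) (hpq : p ≤ q) (hq1 : q ≤ 1) (E : Finset α)
    {f : Finset α → ℝ} (hf : Monotone f) : expect p E f ≤ expect q E f := by
  classical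
  induction E using Finset.induction_on generalizing f with
  | empty => simp [expect_empty]
  | insert a E ha ih =>
    rw [expect_insert p ha, expect_insert q ha]
    have h1 := ih (f := fun S => f (insert a S))
      fun S T hST => hf (Finset.insert_subset_insert a hST)
    have h2 := ih hf
    have h3 : expect q E f ≤ expect q E fun S => f (insert a S) :=
      expect_mono (hp0.trans hpq) hq1 fun S _ => hf (Finset.subset_insert a S)
    nlinarith [mul_le_mul_of_nonneg_left h1 hp0,
      mul_le_mul_of_nonneg_left h2 (by linarith : 0 ≤ 1 - p)]

/-- The Margulis–Russo formula. -/
lemma hasDerivAt_expect [DecidableEq α] (p : ℝ) (E : Finset α) (f : Finset α → ℝ) :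
    HasDerivAt (fun p => expect p E f)
      (∑ e ∈ E, expect p (E.erase e) fun S => f (insert e S) - f S) p := by
  induction E using Finset.induction_on generalizing f with
  | empty => simpa [expect_empty] using hasDerivAt_const p (f ∅)
  | insert a E ha ih =>
    have h1 := (hasDerivAt_id p).mul (ih fun S => f (insert a S))
    have h2 := ((hasDerivAt_id p).const_sub 1).mul (ih f)
    have h := h1.add h2
    have hfun : (fun p => expect p (insert a E) f) =
        (id * fun p => expect p E fun S => f (insert a S)) +
          (fun x => 1 - id x) * fun p => expect p E f := by
      funext r
      simp [expect_insert r ha]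
    rw [hfun]
    refine h.congr_deriv (Eq.symm ?_)
    rw [Finset.sum_insert ha, Finset.erase_insert ha, expect_sub]
    have hterm : ∀ e ∈ E, expect p ((insert a E).erase e) (fun S => f (insert e S) - f S)
        = p * expect p (E.erase e) (fun S => f (insert a (insert e S)) - f (insert a S))
          + (1 - p) * expect p (E.erase e) (fun S => f (insert e S) - f S) := by
      intro e he
      have hae : a ≠ e := fun h => ha (h ▸ he)
      rw [Finset.erase_insert_of_ne hae,
        expect_insert p (fun h => ha (Finset.mem_of_mem_erase h))]
      simp only [Finset.insert_comm e a]
    rw [Finset.sum_congr rfl hterm, Finset.sum_add_distrib, ← Finset.mul_sum, ← Finset.mul_sum]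
    simp only [id]
    ring

lemma expect_erase [DecidableEq α] (p : ℝ) {e : α} {E : Finset α} (he : e ∈ E) (g : Finset α → ℝ) :
    (1 - p) * expect p (E.erase e) g = expect p E fun S => ind (e ∉ S) * g S := by
  conv_rhs => rw [← Finset.insert_erase he]
  rw [expect_insert p (Finset.notMem_erase e E)]
  have h1 : (expect p (E.erase e) fun S => ind (e ∉ insert e S) * g (insert e S)) = 0 := by
    rw [← expect_const p 0 (E.erase e)]
    exact expect_congr fun S _ => by rw [ind_of_not (by simp), zero_mul]
  have h2 : (expect p (E.erase e) fun S => ind (e ∉ S) * g S) = expect p (E.erase e) g :=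
    expect_congr fun S hS => by
      rw [ind_of fun h => Finset.notMem_erase e E (hS h), one_mul]
  rw [h1, h2]; ring

lemma expect_mem (p : ℝ) {e : α} {E : Finset α} (he : e ∈ E) :
    (expect p E fun S => ind (e ∈ S)) = p := by
  classical
  rw [← Finset.insert_erase he, expect_insert p (Finset.notMem_erase e E)]
  have h1 : (expect p (E.erase e) fun S => ind (e ∈ insert e S)) = 1 := by
    rw [← expect_const p 1 (E.erase e)]
    exact expect_congr fun S _ => ind_of (by simp)
  have h2 : (expect p (E.erase e) fun S => ind (e ∈ S)) = 0 := by
    rw [← expect_const p 0 (E.erase e)]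
    exact expect_congr fun S hS => ind_of_not fun h => Finset.notMem_erase e E (hS h)
  rw [h1, h2]; ring

/-- `f S` depends only on the trace of `S` on `F`. -/
def DependsOnly (F : Set α) (f : Finset α → β) : Prop :=
  ∀ S T : Finset α, (∀ e ∈ F, e ∈ S ↔ e ∈ T) → f S = f T

lemma dependsOnly_of_imp {F : Set α} {A : Finset α → Prop}
    (h : ∀ S T : Finset α, (∀ e ∈ F, e ∈ S ↔ e ∈ T) → A S → A T) :
    DependsOnly F fun S => ind (A S) := by
  intro S T hST
  have : A S ↔ A T := ⟨h S T hST, h T S fun e he => (hST e he).symm⟩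
  simp only [this]

lemma DependsOnly.mono {F F' : Set α} {f : Finset α → β} (hf : DependsOnly F f) (h : F ⊆ F') :
    DependsOnly F' f :=
  fun S T hST => hf S T fun e he => hST e (h he)

lemma DependsOnly.mul {F F' : Set α} {f g : Finset α → ℝ} (hf : DependsOnly F f)
    (hg : DependsOnly F' g) : DependsOnly (F ∪ F') fun S => f S * g S := by
  intro S T hST
  simp only [hf S T fun e he => hST e (Or.inl he), hg S T fun e he => hST e (Or.inr he)]

lemma expect_mul_of_disjoint (p : ℝ) (E : Finset α) {F F' : Set α} (hF : Disjoint F F')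
    {f g : Finset α → ℝ} (hf : DependsOnly F f) (hg : DependsOnly F' g) :
    (expect p E fun S => f S * g S) = expect p E f * expect p E g := by
  classical
  have hE : E.filter (· ∈ F) ∪ E.filter (· ∉ F) = E := Finset.filter_union_filter_not_eq _ _
  have hd : Disjoint (E.filter (· ∈ F)) (E.filter (· ∉ F)) :=
    Finset.disjoint_filter_filter_not _ _ _
  have hf' : ∀ S ⊆ E.filter (· ∈ F), ∀ T ⊆ E.filter (· ∉ F), f (S ∪ T) = f S := by
    intro S _ T hT
    refine hf _ _ fun e he => ?_
    have : e ∉ T := fun h => (Finset.mem_filter.1 (hT h)).2 he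
    simp [this]
  have hg' : ∀ S ⊆ E.filter (· ∈ F), ∀ T ⊆ E.filter (· ∉ F), g (S ∪ T) = g T := by
    intro S hS T _
    refine hg _ _ fun e he => ?_
    have : e ∉ S := fun h => Set.disjoint_left.1 hF (Finset.mem_filter.1 (hS h)).2 he
    simp [this]
  have e1 : (expect p E fun S => f S * g S)
      = expect p (E.filter (· ∈ F)) f * expect p (E.filter (· ∉ F)) g := by
    conv_lhs => rw [← hE]
    rw [expect_union p hd, mul_comm, ← expect_const_mul]
    refine expect_congr fun S hS => ?_
    rw [mul_comm, ← expect_const_mul]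
    exact expect_congr fun T hT => by rw [hf' S hS T hT, hg' S hS T hT]
  have e2 : expect p E f = expect p (E.filter (· ∈ F)) f := by
    conv_lhs => rw [← hE]
    rw [expect_union p hd]
    refine expect_congr fun S hS => ?_
    rw [← expect_const p (f S) (E.filter (· ∉ F))]
    exact expect_congr fun T hT => hf' S hS T hT
  have e3 : expect p E g = expect p (E.filter (· ∉ F)) g := by
    conv_lhs => rw [← hE]
    rw [expect_union p hd, ← expect_const p (expect p (E.filter (· ∉ F)) g) (E.filter (· ∈ F))]
    exact expect_congr fun S hS => expect_congr fun T hT => hg' S hS T hT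
  rw [e1, e2, e3]

lemma expect_of_dependsOnly (p : ℝ) {E F : Finset α} (hFE : F ⊆ E) {f : Finset α → ℝ}
    (hf : DependsOnly (F : Set α) f) : expect p E f = expect p F f := by
  classical
  rw [← Finset.union_sdiff_of_subset hFE, expect_union p Finset.disjoint_sdiff]
  refine expect_congr fun S hS => ?_
  rw [← expect_const p (f S) (E \ F)]
  refine expect_congr fun T hT => hf _ _ fun e he => ?_
  have : e ∉ T := fun h => (Finset.mem_sdiff.1 (hT h)).2 he
  simp [this]

lemma expect_le_of_subset {p : ℝ} (hp0 : 0 ≤ p) (hp1 : p ≤ 1) {E F : Finset α} (hEF : E ⊆ F)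
    {f : Finset α → ℝ} (hf : Monotone f) : expect p E f ≤ expect p F f := by
  classical
  rw [← Finset.union_sdiff_of_subset hEF, expect_union p Finset.disjoint_sdiff]
  refine expect_mono hp0 hp1 fun S _ => ?_
  rw [← expect_const p (f S) (F \ E)]
  exact expect_mono hp0 hp1 fun T _ => hf Finset.subset_union_left

end Expectation

section Connectivity

/-- `x` is connected to `y` in `G` by edges of `S`. -/
def Linked (G : SimpleGraph V) (S : Set (Sym2 V)) : V → V → Prop :=
  Relation.ReflTransGen fun a b => G.Adj a b ∧ s(a, b) ∈ S

lemma Linked.mono_of_adj {G : SimpleGraph V} {S S' : Set (Sym2 V)} {x y : V}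
    (hxy : Linked G S x y) (h : ∀ e ∈ S, e ∈ G.edgeSet → e ∈ S') : Linked G S' x y :=
  Relation.ReflTransGen.mono (fun _ _ hab => ⟨hab.1, h _ hab.2 hab.1⟩) _ _ hxy

lemma Linked.mono {G : SimpleGraph V} {S S' : Set (Sym2 V)} (h : S ⊆ S') {x y : V}
    (hxy : Linked G S x y) : Linked G S' x y :=
  hxy.mono_of_adj fun _ he _ => h he

lemma connectedVia_iff (G : SimpleGraph V) (S : Finset (Sym2 V)) (x y : V) :
    connectedVia G S x y ↔ Linked G S x y := by
  constructor
  · rintro ⟨w, hw⟩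
    induction w with
    | nil => exact Relation.ReflTransGen.refl
    | cons h w ih =>
      exact Relation.ReflTransGen.head ⟨h, hw _ (by simp)⟩
        (ih fun e he => hw e (by simp [he]))
  · intro h
    induction h using Relation.ReflTransGen.head_induction_on with
    | refl => exact ⟨SimpleGraph.Walk.nil, by simp⟩
    | head hab _ ih =>
      obtain ⟨w, hw⟩ := ih
      refine ⟨SimpleGraph.Walk.cons hab.1 w, fun e he => ?_⟩
      rw [SimpleGraph.Walk.edges_cons, List.mem_cons] at he
      rcases he with rfl | he
      · exact hab.2
      · exact hw e he

/-- The edges with both endpoints in `P`. -/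
def inside (P : Set V) : Set (Sym2 V) := {e | ∀ x ∈ e, x ∈ P}

/-- The edges with at least one endpoint in `P`. -/
def touching (P : Set V) : Set (Sym2 V) := {e | ∃ x ∈ e, x ∈ P}

@[simp] lemma mk_mem_inside {P : Set V} {a b : V} : s(a, b) ∈ inside P ↔ a ∈ P ∧ b ∈ P := by
  simp [inside]

@[simp] lemma mk_mem_touching {P : Set V} {a b : V} :
    s(a, b) ∈ touching P ↔ a ∈ P ∨ b ∈ P := by
  simp [touching]

/-- Decomposition of an open path at its last visit to `P`. -/
lemma Linked.last_exit {G : SimpleGraph V} {S : Set (Sym2 V)} {P : Set V} {x z : V}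
    (h : Linked G S x z) (hz : z ∉ P) :
    (x ∉ P ∧ Linked G (S \ touching P) x z) ∨
      ∃ a b, a ∈ P ∧ b ∉ P ∧ G.Adj a b ∧ s(a, b) ∈ S ∧ Linked G (S \ touching P) b z := by
  induction h using Relation.ReflTransGen.head_induction_on with
  | refl => exact Or.inl ⟨hz, Relation.ReflTransGen.refl⟩
  | @head a c hac _ ih =>
    rcases ih with ⟨hc, hcz⟩ | h
    · by_cases ha : a ∈ P
      · exact Or.inr ⟨a, c, ha, hc, hac.1, hac.2, hcz⟩
      · exact Or.inl ⟨ha, Relation.ReflTransGen.head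
          ⟨hac.1, hac.2, by simp [ha, hc]⟩ hcz⟩
    · exact Or.inr h

/-- The initial piece of an open path, up to its first exit of `P`. -/
lemma Linked.first_exit {G : SimpleGraph V} {S : Set (Sym2 V)} {P : Set V} {x z : V}
    (h : Linked G S x z) (hx : x ∈ P) (hz : z ∉ P) :
    ∃ y, y ∉ P ∧ Linked G (S ∩ touching P) x y := by
  have key : ∀ y, Linked G S x y → (y ∈ P ∧ Linked G (S ∩ touching P) x y) ∨
      ∃ y, y ∉ P ∧ Linked G (S ∩ touching P) x y := by
    intro y hy
    induction hy with
    | refl => exact Or.inl ⟨hx, Relation.ReflTransGen.refl⟩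
    | @tail b c _ hbc ih =>
      rcases ih with ⟨hb, hxb⟩ | h
      · have hxc : Linked G (S ∩ touching P) x c :=
          Relation.ReflTransGen.tail hxb ⟨hbc.1, hbc.2, by simp [hb]⟩
        by_cases hc : c ∈ P
        · exact Or.inl ⟨hc, hxc⟩
        · exact Or.inr ⟨c, hc, hxc⟩
      · exact Or.inr h
  exact (key z h).resolve_left fun h => hz h.1

/-- `x` is connected by edges of `S` to the complement of `B`. -/
def Escapes (G : SimpleGraph V) (B : Set V) (x : V) (S : Finset (Sym2 V)) : Prop :=
  ∃ z, z ∉ B ∧ Linked G S x z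

lemma Escapes.mono {G : SimpleGraph V} {B : Set V} {x : V} {S S' : Finset (Sym2 V)}
    (h : S ⊆ S') (hx : Escapes G B x S) : Escapes G B x S' :=
  hx.imp fun _ hz => ⟨hz.1, hz.2.mono (Finset.coe_subset.2 h)⟩

lemma monotone_escapes (G : SimpleGraph V) (B : Set V) (x : V) :
    Monotone fun S => ind (Escapes G B x S) :=
  fun _ _ h => ind_mono (Escapes.mono h)

lemma dependsOnly_escapes (G : SimpleGraph V) (B : Set V) (x : V) :
    DependsOnly (touching B ∩ G.edgeSet) fun S => ind (Escapes G B x S) := by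
  refine dependsOnly_of_imp fun S T hST ⟨z, hz, hxz⟩ => ?_
  by_cases hx : x ∈ B
  · obtain ⟨y, hy, hxy⟩ := hxz.first_exit hx hz
    refine ⟨y, hy, hxy.mono_of_adj fun e he heG => ?_⟩
    exact (hST e ⟨he.2, heG⟩).1 he.1
  · exact ⟨x, hx, Relation.ReflTransGen.refl⟩

/-- The set of vertices that do not escape `B` is exactly `T`. -/
def TrappedEq (G : SimpleGraph V) (B : Set V) (T : Finset V) (S : Finset (Sym2 V)) : Prop :=
  ∀ x, x ∈ T ↔ ¬ Escapes G B x S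

lemma dependsOnly_trappedEq (G : SimpleGraph V) (B : Set V) (T : Finset V) :
    DependsOnly (inside (T : Set V))ᶜ fun S => ind (TrappedEq G B T S) := by
  refine dependsOnly_of_imp fun S S' hS hT x => ?_
  have hsub : (S : Set (Sym2 V)) \ touching (T : Set V) ⊆ S' := by
    intro e he
    refine (hS e fun h => he.2 ?_).1 he.1
    induction e with
    | _ a b => simp at h ⊢; exact Or.inl h.1
  have hsub' : (S' : Set (Sym2 V)) \ touching (T : Set V) ⊆ S := by
    intro e he
    refine (hS e fun h => he.2 ?_).2 he.1
    induction e with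
    | _ a b => simp at h ⊢; exact Or.inl h.1
  constructor
  · rintro hx ⟨z, hz, hxz⟩
    have hzT : z ∉ (T : Set V) := fun h =>
      (hT z).1 h ⟨z, hz, Relation.ReflTransGen.refl⟩
    rcases hxz.last_exit hzT with ⟨h, -⟩ | ⟨a, b, ha, hb, hab, habS, hbz⟩
    · exact h hx
    · refine (hT a).1 ha ⟨z, hz, Relation.ReflTransGen.head ⟨hab, ?_⟩ (hbz.mono hsub')⟩
      refine (hS _ fun h => hb ?_).2 habS
      simp at h; exact h.2
  · intro hx
    by_contra hxT
    obtain ⟨z, hz, hxz⟩ : Escapes G B x S := by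
      by_contra h; exact hxT ((hT x).2 h)
    have hzT : z ∉ (T : Set V) := fun h =>
      (hT z).1 h ⟨z, hz, Relation.ReflTransGen.refl⟩
    rcases hxz.last_exit hzT with ⟨_, h⟩ | ⟨a, b, ha, hb, hab, habS, hbz⟩
    · exact hx ⟨z, hz, h.mono hsub⟩
    · exact (hT a).1 ha ⟨z, hz, Relation.ReflTransGen.head ⟨hab, habS⟩ (hbz.mono Set.sdiff_subset)⟩

/-- The edge `e` leaves `T` from a vertex linked to `o` inside `T`. -/
def BoundaryLinked (G : SimpleGraph V) (T : Set V) (o : V) (e : Sym2 V) (S : Finset (Sym2 V)) :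
    Prop :=
  ∃ x y, e = s(x, y) ∧ G.Adj x y ∧ x ∈ T ∧ y ∉ T ∧ Linked G (S ∩ inside T) o x

lemma dependsOnly_boundaryLinked (G : SimpleGraph V) (T : Set V) (o : V) (e : Sym2 V) :
    DependsOnly (inside T ∩ G.edgeSet) fun S => ind (BoundaryLinked G T o e S) := by
  refine dependsOnly_of_imp fun S S' hS ⟨x, y, he, hxy, hx, hy, h⟩ =>
    ⟨x, y, he, hxy, hx, hy, h.mono_of_adj fun f hf hfG => ?_⟩
  exact ⟨(hS f ⟨hf.2, hfG⟩).1 hf.1, hf.2⟩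

lemma monotone_boundaryLinked (G : SimpleGraph V) (T : Set V) (o : V) (e : Sym2 V) :
    Monotone fun S => ind (BoundaryLinked G T o e S) := by
  intro S S' h
  refine ind_mono fun ⟨x, y, he, hxy, hx, hy, hl⟩ => ⟨x, y, he, hxy, hx, hy, hl.mono ?_⟩
  exact Set.inter_subset_inter_left _ (Finset.coe_subset.2 h)

/-- The cluster of `o` in the configuration restricted to `T` is exactly `C`. -/
def ClusterEq (G : SimpleGraph V) (T : Set V) (o : V) (C : Finset V) (S : Finset (Sym2 V)) :
    Prop :=
  ∀ x, x ∈ C ↔ Linked G (S ∩ inside T) o x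

lemma dependsOnly_clusterEq (G : SimpleGraph V) (T : Set V) (o : V) (C : Finset V) :
    DependsOnly (inside T ∩ touching (C : Set V)) fun S => ind (ClusterEq G T o C S) := by
  refine dependsOnly_of_imp fun S S' hS hC x => ?_
  constructor
  · intro hx
    have hl := (hC x).1 hx
    clear hx
    induction hl with
    | refl => exact Relation.ReflTransGen.refl
    | @tail b c hb hbc ih =>
      have hbC : b ∈ C := (hC b).2 hb
      exact Relation.ReflTransGen.tail ih
        ⟨hbc.1, (hS _ ⟨hbc.2.2, by simp [hbC]⟩).1 hbc.2.1, hbc.2.2⟩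
  · intro hl
    induction hl with
    | refl => exact (hC o).2 Relation.ReflTransGen.refl
    | @tail b c _ hbc ih =>
      exact (hC c).2 (Relation.ReflTransGen.tail ((hC b).1 ih)
        ⟨hbc.1, (hS _ ⟨hbc.2.2, by simp [ih]⟩).2 hbc.2.1, hbc.2.2⟩)

/-- The edge `e` goes from `C` to the complement of `T`, and from its endpoint outside `T` one
escapes `B` without touching `C`. -/
def EscapesBeyond (G : SimpleGraph V) (B T C : Set V) (e : Sym2 V) (S : Finset (Sym2 V)) : Prop :=
  ∃ x y, e = s(x, y) ∧ G.Adj x y ∧ x ∈ C ∧ y ∉ T ∧ ∃ z, z ∉ B ∧ Linked G (S \ touching C) y z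

lemma dependsOnly_escapesBeyond (G : SimpleGraph V) (B T C : Set V) (e : Sym2 V) :
    DependsOnly (touching C)ᶜ fun S => ind (EscapesBeyond G B T C e S) := by
  refine dependsOnly_of_imp fun S S' hS ⟨x, y, he, hxy, hx, hy, z, hz, h⟩ =>
    ⟨x, y, he, hxy, hx, hy, z, hz,
      h.mono_of_adj fun f hf _ => ⟨(hS f hf.2).1 hf.1, hf.2⟩⟩

lemma inBall_zero (G : SimpleGraph V) (v x : V) : inBall G v 0 x ↔ x = v := by
  constructor
  · rintro ⟨w, hw⟩
    exact (SimpleGraph.Walk.eq_of_length_eq_zero (Nat.le_zero.1 hw)).symm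
  · rintro rfl
    exact ⟨SimpleGraph.Walk.nil, by simp⟩

lemma inBall.mono {G : SimpleGraph V} {v x : V} {m n : ℕ} (h : m ≤ n) (hx : inBall G v m x) :
    inBall G v n x :=
  hx.imp fun _ hw => hw.trans h

lemma inBall_self (G : SimpleGraph V) (v : V) (n : ℕ) : inBall G v n v :=
  ⟨SimpleGraph.Walk.nil, by simp⟩

lemma inBall.trans {G : SimpleGraph V} {u v x : V} {m n : ℕ} (h : inBall G u m v)
    (hx : inBall G v n x) : inBall G u (m + n) x := by
  obtain ⟨w, hw⟩ := h
  obtain ⟨w', hw'⟩ := hx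
  exact ⟨w.append w', by rw [SimpleGraph.Walk.length_append]; omega⟩

lemma inBall_of_adj {G : SimpleGraph V} {x y : V} (h : G.Adj x y) : inBall G x 1 y :=
  ⟨SimpleGraph.Walk.cons h SimpleGraph.Walk.nil, by simp⟩

lemma inBall_succ (G : SimpleGraph V) (v x : V) (n : ℕ) :
    inBall G v (n + 1) x ↔ inBall G v n x ∨ ∃ y, inBall G v n y ∧ G.Adj y x := by
  constructor
  · rintro ⟨w, hw⟩
    rcases Nat.lt_or_ge w.length (n + 1) with h | h
    · exact Or.inl ⟨w, by omega⟩
    · refine Or.inr ⟨w.penultimate, ⟨w.dropLast, ?_⟩, w.adj_penultimate ?_⟩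
      · have := w.length_dropLast_add_one (SimpleGraph.Walk.not_nil_iff_lt_length.2 (by omega))
        omega
      · exact SimpleGraph.Walk.not_nil_iff_lt_length.2 (by omega)
  · rintro (h | ⟨y, hy, hyx⟩)
    · exact h.mono (Nat.le_succ n)
    · exact hy.trans (inBall_of_adj hyx)

/-- The ball, as a set. -/
def ballSet (G : SimpleGraph V) (v : V) (n : ℕ) : Set V := {x | inBall G v n x}

lemma finite_ballSet {G : SimpleGraph V} (hlf : ∀ v, (G.neighborSet v).Finite) (v : V) (n : ℕ) :
    (ballSet G v n).Finite := by
  induction n with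
  | zero =>
    refine (Set.finite_singleton v).subset fun x hx => ?_
    exact (inBall_zero G v x).1 hx
  | succ n ih =>
    refine (ih.union (ih.biUnion fun y _ => hlf y)).subset fun x hx => ?_
    rcases (inBall_succ G v x n).1 hx with h | ⟨y, hy, hyx⟩
    · exact Or.inl h
    · exact Or.inr (Set.mem_biUnion hy hyx)

lemma finite_touching {G : SimpleGraph V} (hlf : ∀ v, (G.neighborSet v).Finite) {B : Set V}
    (hB : B.Finite) : (touching B ∩ G.edgeSet).Finite := by
  refine (hB.biUnion fun x _ => (hlf x).image fun y => s(x, y)).subset ?_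
  rintro e ⟨⟨x, hxe, hx⟩, he⟩
  obtain ⟨y, rfl⟩ := Sym2.mem_iff_exists.1 hxe
  exact Set.mem_biUnion hx ⟨y, he, rfl⟩

end Connectivity

section Escape

variable {W : Type*}

lemma cylProb_le_one {p : ℝ} (hp0 : 0 ≤ p) (hp1 : p ≤ 1) (A : Finset (Sym2 V) → Prop)
    (E : Finset (Sym2 V)) : cylProb p E A ≤ 1 := by
  rw [cylProb_eq_expect, ← expect_const p 1 E]
  exact expect_mono hp0 hp1 fun S _ => ind_le_one _

lemma expect_le_prob {p : ℝ} (hp0 : 0 ≤ p) (hp1 : p ≤ 1) (A : Finset (Sym2 V) → Prop)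
    (E : Finset (Sym2 V)) : (expect p E fun S => ind (A S)) ≤ prob p A := by
  rw [← cylProb_eq_expect]
  exact le_ciSup (f := fun E => cylProb p E A)
    ⟨1, by rintro _ ⟨F, rfl⟩; exact cylProb_le_one hp0 hp1 A F⟩ E

lemma prob_eq_expect {p : ℝ} (hp0 : 0 ≤ p) (hp1 : p ≤ 1) {A : Finset (Sym2 V) → Prop}
    {F : Finset (Sym2 V)} (hmono : Monotone fun S => ind (A S))
    (hdep : DependsOnly (F : Set (Sym2 V)) fun S => ind (A S)) :
    prob p A = expect p F fun S => ind (A S) := by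
  classical
  refine le_antisymm (ciSup_le fun E => ?_) (expect_le_prob hp0 hp1 A F)
  rw [cylProb_eq_expect, ← expect_of_dependsOnly p (E := E ∪ F) Finset.subset_union_right hdep]
  exact expect_le_of_subset hp0 hp1 Finset.subset_union_left hmono

/-- The probability that `v` is connected to the complement of its `n`-ball. -/
noncomputable def escapeProb (G : SimpleGraph V) (p : ℝ) (v : V) (n : ℕ) : ℝ :=
  prob p (Escapes G (ballSet G v n) v)

lemma theta_eq (G : SimpleGraph V) (p : ℝ) (v : V) : theta G p v = ⨅ n, escapeProb G p v n := by
  simp only [theta, escapeProb, connectedVia_iff]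
  rfl

lemma escapeProb_nonneg {p : ℝ} (hp0 : 0 ≤ p) (hp1 : p ≤ 1) (G : SimpleGraph V) (v : V) (n : ℕ) :
    0 ≤ escapeProb G p v n := by
  refine le_trans ?_ (expect_le_prob hp0 hp1 _ ∅)
  rw [expect_empty]
  exact ind_nonneg _

lemma theta_le_escapeProb {p : ℝ} (hp0 : 0 ≤ p) (hp1 : p ≤ 1) (G : SimpleGraph V) (v : V)
    (n : ℕ) : theta G p v ≤ escapeProb G p v n := by
  rw [theta_eq]
  exact ciInf_le ⟨0, by rintro _ ⟨m, rfl⟩; exact escapeProb_nonneg hp0 hp1 G v m⟩ n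

lemma escapeProb_eq_expect {p : ℝ} (hp0 : 0 ≤ p) (hp1 : p ≤ 1) (G : SimpleGraph V) (v : V)
    (n : ℕ) {E : Finset (Sym2 V)} (hE : touching (ballSet G v n) ∩ G.edgeSet ⊆ E) :
    escapeProb G p v n = expect p E fun S => ind (Escapes G (ballSet G v n) v S) :=
  prob_eq_expect hp0 hp1 (monotone_escapes G _ v) ((dependsOnly_escapes G _ v).mono hE)

lemma BallIso.symm {G : SimpleGraph V} {H : SimpleGraph W} {v : V} {w : W} {R : ℕ}
    (h : BallIso G H v w R) : BallIso H G w v R := by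
  obtain ⟨φ, hφ, hadj⟩ := h
  refine ⟨φ.symm, ?_, fun a b => ?_⟩
  · have : φ ⟨v, inBall_self G v R⟩ = ⟨w, inBall_self H w R⟩ := Subtype.ext hφ
    rw [← this, Equiv.symm_apply_apply]
  · rw [hadj, Equiv.apply_symm_apply, Equiv.apply_symm_apply]

lemma inBall.map {G : SimpleGraph V} {H : SimpleGraph W} (φ : G →g H) {u x : V} {n : ℕ}
    (h : inBall G u n x) : inBall H (φ u) n (φ x) := by
  obtain ⟨w, hw⟩ := h
  exact ⟨w.map φ, by simpa using hw⟩

lemma ballIso_of_iso {G : SimpleGraph V} (φ : G ≃g G) (u : V) (R : ℕ) :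
    BallIso G G u (φ u) R := by
  refine ⟨φ.toEquiv.subtypeEquiv fun x => ⟨fun h => h.map φ.toHom, fun h => ?_⟩, rfl,
    fun a b => φ.map_adj_iff.symm⟩
  simpa using h.map φ.symm.toHom

lemma inBall_symm_apply {G : SimpleGraph V} {H : SimpleGraph W} {v : V} {w : W} {R : ℕ}
    (φ : {x : V // inBall G v R x} ≃ {y : W // inBall H w R y})
    (hφ : (φ ⟨v, inBall_self G v R⟩).1 = w)
    (hadj : ∀ a b : {x : V // inBall G v R x}, G.Adj a.1 b.1 ↔ H.Adj (φ a).1 (φ b).1)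
    {k : ℕ} (hk : k ≤ R) (x : {x : V // inBall G v R x}) (hx : inBall H w k (φ x).1) :
    inBall G v k x.1 := by
  induction k generalizing x with
  | zero =>
    rw [inBall_zero] at hx ⊢
    have : φ x = φ ⟨v, inBall_self G v R⟩ := Subtype.ext (hx.trans hφ.symm)
    rw [φ.injective this]
  | succ k ih =>
    rw [inBall_succ] at hx ⊢
    rcases hx with h | ⟨y, hy, hyx⟩
    · exact Or.inl (ih (by omega) x h)
    · obtain ⟨a, ha⟩ := φ.surjective ⟨y, hy.mono (by omega)⟩
      have hay : (φ a).1 = y := by rw [ha]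
      refine Or.inr ⟨a.1, ih (by omega) a (by rwa [hay]), (hadj a x).2 (by rwa [hay])⟩

lemma escapeProb_le_of_ballIso {G : SimpleGraph V} {H : SimpleGraph W}
    (hlf : ∀ v, (G.neighborSet v).Finite) {v : V} {w : W} {n : ℕ} {p : ℝ} (hp0 : 0 ≤ p)
    (hp1 : p ≤ 1) (h : BallIso G H v w (n + 1)) : escapeProb G p v n ≤ escapeProb H p w n := by
  classical
  obtain ⟨φ, hφ, hadj⟩ := h
  set f : V → W := fun x => if hx : inBall G v (n + 1) x then (φ ⟨x, hx⟩).1 else w with hf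
  have hfx : ∀ x (hx : inBall G v (n + 1) x), f x = (φ ⟨x, hx⟩).1 := fun x hx => by
    simp only [hf, dif_pos hx]
  have hinj : ∀ x y, inBall G v (n + 1) x → inBall G v (n + 1) y → f x = f y → x = y := by
    intro x y hx hy hxy
    rw [hfx x hx, hfx y hy] at hxy
    exact congrArg Subtype.val (φ.injective (Subtype.ext hxy))
  have hEfin := finite_touching hlf (finite_ballSet hlf v n)
  set E := hEfin.toFinset with hE
  have hmem : ∀ a b, s(a, b) ∈ E →
      G.Adj a b ∧ inBall G v (n + 1) a ∧ inBall G v (n + 1) b := by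
    intro a b hab
    rw [hE, Set.Finite.mem_toFinset] at hab
    obtain ⟨h1, h2⟩ := hab
    refine ⟨h2, ?_⟩
    rcases mk_mem_touching.1 h1 with h | h
    · exact ⟨inBall.mono (Nat.le_succ n) h, inBall.trans h (inBall_of_adj h2)⟩
    · exact ⟨inBall.trans h (inBall_of_adj (SimpleGraph.Adj.symm h2)), inBall.mono (Nat.le_succ n) h⟩
  have hinjE : Set.InjOn (Sym2.map f) E := by
    intro e he e' he' hee
    induction e with | _ a b =>
    induction e' with | _ c d =>
    obtain ⟨-, ha, hb⟩ := hmem a b he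
    obtain ⟨-, hc, hd⟩ := hmem c d he'
    rw [Sym2.map_mk, Sym2.map_mk, Sym2.eq_iff] at hee
    rw [Sym2.eq_iff]
    rcases hee with ⟨h1, h2⟩ | ⟨h1, h2⟩
    · exact Or.inl ⟨hinj _ _ ha hc h1, hinj _ _ hb hd h2⟩
    · exact Or.inr ⟨hinj _ _ ha hd h1, hinj _ _ hb hc h2⟩
  rw [escapeProb_eq_expect hp0 hp1 G v n (E := E) (by simp [hE])]
  refine le_trans ?_ (expect_le_prob hp0 hp1 _ (E.image (Sym2.map f)))
  rw [expect_image p hinjE]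
  refine expect_mono hp0 hp1 fun S hS => ind_mono ?_
  rintro ⟨z, hz, hvz⟩
  have key : ∀ x, Linked G S v x →
      (inBall G v n x ∧ Linked H (S.image (Sym2.map f)) w (f x)) ∨
        Escapes H (ballSet H w n) w (S.image (Sym2.map f)) := by
    intro x hx
    induction hx with
    | refl =>
      refine Or.inl ⟨inBall_self G v n, ?_⟩
      rw [hfx v (inBall_self G v _), hφ]
      exact Relation.ReflTransGen.refl
    | @tail b c _ hbc ih =>
      rcases ih with ⟨hb, hl⟩ | h
      · have hbc' := hmem b c (hS hbc.2)
        have hlc : Linked H (S.image (Sym2.map f)) w (f c) := by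
          refine Relation.ReflTransGen.tail hl ⟨?_, ?_⟩
          · rw [hfx b hbc'.2.1, hfx c hbc'.2.2]
            exact (hadj _ _).1 hbc'.1
          · exact Finset.mem_coe.2 (Finset.mem_image.2 ⟨s(b, c), hbc.2, rfl⟩)
        by_cases hc : inBall G v n c
        · exact Or.inl ⟨hc, hlc⟩
        · refine Or.inr ⟨f c, fun hfc => hc ?_, hlc⟩
          have hfc' : inBall H w n (f c) := hfc
          rw [hfx c hbc'.2.2] at hfc'
          exact inBall_symm_apply φ hφ hadj (Nat.le_succ n) ⟨c, hbc'.2.2⟩ hfc'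
      · exact Or.inr h
  exact (key z hvz).resolve_left fun h => hz h.1

lemma escapeProb_eq_of_isTransitive {G : SimpleGraph V} (hlf : ∀ v, (G.neighborSet v).Finite)
    (htr : IsTransitive G) {p : ℝ} (hp0 : 0 ≤ p) (hp1 : p ≤ 1) (u v : V) (n : ℕ) :
    escapeProb G p u n = escapeProb G p v n := by
  obtain ⟨φ, rfl⟩ := htr u v
  have h := ballIso_of_iso φ u (n + 1)
  exact le_antisymm (escapeProb_le_of_ballIso hlf hp0 hp1 h)
    (escapeProb_le_of_ballIso hlf hp0 hp1 h.symm)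

lemma expect_one (E : Finset (Sym2 V)) (f : Finset (Sym2 V) → ℝ) : expect 1 E f = f E := by
  classical
  induction E using Finset.induction_on generalizing f with
  | empty => exact expect_empty 1 f
  | insert a E ha ih => rw [expect_insert 1 ha, ih]; ring

lemma theta_one_pos {G : SimpleGraph V} (hlf : ∀ v, (G.neighborSet v).Finite)
    (hconn : G.Connected) [Infinite V] (v : V) : 0 < theta G 1 v := by
  classical
  rw [theta_eq]
  refine lt_of_lt_of_le one_pos (le_ciInf fun n => ?_)
  obtain ⟨x, hx⟩ := (finite_ballSet hlf v n).exists_notMem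
  obtain ⟨w⟩ := hconn.preconnected v x
  refine le_trans (le_of_eq ?_) (expect_le_prob zero_le_one le_rfl _ w.edges.toFinset)
  rw [expect_one, ind_of]
  exact ⟨x, hx, (connectedVia_iff G _ v x).1 ⟨w, fun e he => by simpa using he⟩⟩

end Escape

section Sharpness

/-- The pointwise decomposition of an escape along the cluster of `o` inside `T`. -/
lemma ind_escapes_le_sum {G : SimpleGraph V} {B : Set V} {T : Finset V} {o : V} (ho : o ∈ T)
    (hTB : (T : Set V) ⊆ B) {E : Finset (Sym2 V)} (hE : touching B ∩ G.edgeSet ⊆ E)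
    (S : Finset (Sym2 V)) :
    ind (Escapes G B o S) ≤ ∑ C ∈ T.powerset, ∑ e ∈ E,
      ind (ClusterEq G T o C S) * (ind (e ∈ S) * ind (EscapesBeyond G B T C e S)) := by
  classical
  have hnn : ∀ C ∈ T.powerset, ∀ e ∈ E, 0 ≤
      ind (ClusterEq G T o C S) * (ind (e ∈ S) * ind (EscapesBeyond G B T C e S)) :=
    fun C _ e _ => mul_nonneg (ind_nonneg _) (mul_nonneg (ind_nonneg _) (ind_nonneg _))
  by_cases h : Escapes G B o S
  swap
  · rw [ind_of_not h]
    exact Finset.sum_nonneg fun C hC => Finset.sum_nonneg (hnn C hC)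
  obtain ⟨z, hz, hoz⟩ := h
  set C : Finset V := T.filter fun x => Linked G (S ∩ inside (T : Set V)) o x with hCdef
  have hC : ClusterEq G T o C S := by
    intro x
    rw [hCdef, Finset.mem_filter]
    refine ⟨fun h => h.2, fun h => ⟨?_, h⟩⟩
    cases h with
    | refl => exact ho
    | tail _ hbc => exact (mk_mem_inside.1 hbc.2.2).2
  have hoC : o ∈ (C : Set V) := (hC o).2 Relation.ReflTransGen.refl
  have hCT : C ⊆ T := Finset.filter_subset _ _
  have hzC : z ∉ (C : Set V) := fun h => hz (hTB (hCT h))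
  obtain ⟨a, b, ha, hb, hab, habS, hbz⟩ :=
    (hoz.last_exit hzC).resolve_left fun h => h.1 hoC
  have hbT : b ∉ (T : Set V) := fun h => hb ((hC b).2
    (Relation.ReflTransGen.tail ((hC a).1 ha) ⟨hab, habS, by simpa using ⟨hCT ha, h⟩⟩))
  have heE : s(a, b) ∈ E := hE ⟨by simpa using Or.inl (hTB (hCT ha)), hab⟩
  have hCmem : C ∈ T.powerset := Finset.mem_powerset.2 hCT
  have hEB : EscapesBeyond G B T C s(a, b) S := ⟨a, b, rfl, hab, ha, hbT, z, hz, hbz⟩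
  calc ind (Escapes G B o S) ≤ 1 := ind_le_one _
    _ = ind (ClusterEq G T o C S) *
        (ind (s(a, b) ∈ S) * ind (EscapesBeyond G B T C s(a, b) S)) := by
      rw [ind_of hC, ind_of (Finset.mem_coe.1 habS),
        ind_of hEB]
      norm_num
    _ ≤ ∑ e ∈ E, ind (ClusterEq G T o C S) *
        (ind (e ∈ S) * ind (EscapesBeyond G B T C e S)) :=
      Finset.single_le_sum
        (f := fun e => ind (ClusterEq G T o C S) *
          (ind (e ∈ S) * ind (EscapesBeyond G B T C e S))) (hnn C hCmem) heE
    _ ≤ _ := Finset.single_le_sum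
        (f := fun C => ∑ e ∈ E, ind (ClusterEq G T o C S) *
          (ind (e ∈ S) * ind (EscapesBeyond G B T C e S)))
        (fun C hC => Finset.sum_nonneg (hnn C hC)) hCmem

lemma expect_escapesBeyond_le {G : SimpleGraph V} (hlf : ∀ v, (G.neighborSet v).Finite)
    (htr : IsTransitive G) {q : ℝ} (hq0 : 0 ≤ q) (hq1 : q ≤ 1) {o : V} {R k : ℕ}
    {T C : Finset V} (hTB : (T : Set V) ⊆ ballSet G o R) (hCT : C ⊆ T) {E : Finset (Sym2 V)}
    {e : Sym2 V} (he : e ∈ E) :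
    (expect q E fun S => ind (ClusterEq G T o C S) * (ind (e ∈ S) *
        ind (EscapesBeyond G (ballSet G o (R + 1 + k)) T C e S))) ≤
      q * escapeProb G q o k * expect q E fun S => ind (ClusterEq G T o C S) *
        ind (∃ x y, e = s(x, y) ∧ G.Adj x y ∧ x ∈ C ∧ y ∉ T) := by
  by_cases hQ : ∃ x y, e = s(x, y) ∧ G.Adj x y ∧ x ∈ C ∧ y ∉ T
  swap
  · have hL : ∀ S, ¬ EscapesBeyond G (ballSet G o (R + 1 + k)) T C e S :=
      fun S ⟨x, y, h1, h2, h3, h4, _⟩ => hQ ⟨x, y, h1, h2, h3, h4⟩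
    simp only [ind_of_not hQ, ind_of_not (hL _), mul_zero, expect_const, le_refl]
  obtain ⟨x, y, rfl, hxy, hx, hy⟩ := id hQ
  simp only [ind_of hQ, mul_one]
  have hmem : DependsOnly {s(x, y)} fun S : Finset (Sym2 V) => ind (s(x, y) ∈ S) :=
    dependsOnly_of_imp fun S S' h hS => (h _ rfl).1 hS
  have hesc := dependsOnly_escapesBeyond G (ballSet G o (R + 1 + k)) (T : Set V) (C : Set V)
    s(x, y)
  have d1 : Disjoint ({s(x, y)} : Set (Sym2 V)) (touching (C : Set V))ᶜ := by
    rw [Set.disjoint_singleton_left]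
    exact fun h => h (by simpa using Or.inl hx)
  have d2 : Disjoint (inside (T : Set V) ∩ touching (C : Set V))
      ({s(x, y)} ∪ (touching (C : Set V))ᶜ) := by
    rw [Set.disjoint_left]
    rintro f ⟨hf1, hf2⟩ (rfl | hf)
    · exact hy (mk_mem_inside.1 hf1).2
    · exact hf hf2
  rw [expect_mul_of_disjoint q E d2 (dependsOnly_clusterEq G T o C) (hmem.mul hesc),
    expect_mul_of_disjoint q E d1 hmem hesc, expect_mem q he, mul_comm]
  refine mul_le_mul_of_nonneg_right (mul_le_mul_of_nonneg_left ?_ hq0) ?_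
  · rw [escapeProb_eq_of_isTransitive hlf htr hq0 hq1 o y k]
    refine le_trans (expect_mono hq0 hq1 fun S _ => ind_mono ?_) (expect_le_prob hq0 hq1 _ E)
    rintro ⟨x', y', hxy', -, hx', hy', z, hz, hl⟩
    have hyy : y = y' := by
      rcases Sym2.eq_iff.1 hxy' with ⟨-, h⟩ | ⟨-, h⟩
      · exact h
      · exact absurd (hCT (h ▸ hx')) hy
    subst hyy
    refine ⟨z, fun hz' => hz ?_, hl.mono Set.sdiff_subset⟩
    exact inBall.trans (inBall.trans (hTB (hCT hx)) (inBall_of_adj hxy)) hz'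
  · rw [← expect_const q 0 E]
    exact expect_mono hq0 hq1 fun S _ => ind_nonneg _

lemma sum_cluster_le_boundaryLinked (G : SimpleGraph V) (T : Finset V) (o : V) (e : Sym2 V)
    (S : Finset (Sym2 V)) :
    ∑ C ∈ T.powerset, ind (ClusterEq G T o C S) *
        ind (∃ x y, e = s(x, y) ∧ G.Adj x y ∧ x ∈ C ∧ y ∉ T) ≤
      ind (BoundaryLinked G T o e S) := by
  simp only [ind_mul]
  refine sum_ind_le _ _ _ (fun C _ C' _ h h' => ?_) fun C hC h => ?_
  · ext x
    rw [h.1 x, h'.1 x]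
  · obtain ⟨h1, x, y, he, hxy, hx, hy⟩ := h
    exact ⟨x, y, he, hxy, Finset.mem_powerset.1 hC hx, hy, (h1 x).1 hx⟩

/-- If `θ(q) > 0` then the expected number of open boundary edges of `T` joined to `o` inside `T`
is at least `1`, for every finite set `T` containing `o`. -/
lemma one_le_of_theta_pos {G : SimpleGraph V} (hlf : ∀ v, (G.neighborSet v).Finite)
    (htr : IsTransitive G) {q : ℝ} (hq0 : 0 ≤ q) (hq1 : q ≤ 1) {o : V} (hθ : 0 < theta G q o)
    {R : ℕ} {T : Finset V} (ho : o ∈ T) (hTB : (T : Set V) ⊆ ballSet G o R)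
    {E : Finset (Sym2 V)} (hE : touching (ballSet G o R) ∩ G.edgeSet ⊆ E) :
    1 ≤ q * ∑ e ∈ E, expect q E fun S => ind (BoundaryLinked G T o e S) := by
  classical
  set X := ∑ e ∈ E, expect q E fun S => ind (BoundaryLinked G T o e S) with hX
  have hX0 : 0 ≤ X := Finset.sum_nonneg fun e _ => by
    rw [← expect_const q 0 E]
    exact expect_mono hq0 hq1 fun S _ => ind_nonneg _
  have step : ∀ k, theta G q o ≤ q * X * escapeProb G q o k := by
    intro k
    have hfin := finite_touching hlf (finite_ballSet hlf o (R + 1 + k))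
    set E' := E ∪ hfin.toFinset with hE'
    have hE'sub : touching (ballSet G o (R + 1 + k)) ∩ G.edgeSet ⊆ E' := by
      rw [hE']; simp
    have hTB' : (T : Set V) ⊆ ballSet G o (R + 1 + k) :=
      hTB.trans fun x hx => inBall.mono (by omega) hx
    have hXE' : ∑ e ∈ E', expect q E' (fun S => ind (BoundaryLinked G T o e S)) = X := by
      have hdep : ∀ e, expect q E' (fun S => ind (BoundaryLinked G T o e S))
          = expect q E fun S => ind (BoundaryLinked G T o e S) := by
        intro e
        refine expect_of_dependsOnly q Finset.subset_union_left
          ((dependsOnly_boundaryLinked G T o e).mono fun f hf => hE ⟨?_, hf.2⟩)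
        obtain ⟨hf1, -⟩ := hf
        induction f with
        | _ a b => exact mk_mem_touching.2 (Or.inl (hTB (mk_mem_inside.1 hf1).1))
      simp only [hdep]
      symm
      refine Finset.sum_subset Finset.subset_union_left fun e _ he => ?_
      rw [← expect_const q 0 E]
      refine expect_congr fun S _ => ind_of_not ?_
      rintro ⟨x, y, rfl, hxy, hx, -⟩
      exact he (hE ⟨mk_mem_touching.2 (Or.inl (hTB hx)), hxy⟩)
    calc theta G q o ≤ escapeProb G q o (R + 1 + k) := theta_le_escapeProb hq0 hq1 G o _
      _ = expect q E' fun S => ind (Escapes G (ballSet G o (R + 1 + k)) o S) :=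
        escapeProb_eq_expect hq0 hq1 G o _ hE'sub
      _ ≤ expect q E' fun S => ∑ C ∈ T.powerset, ∑ e ∈ E', ind (ClusterEq G T o C S) *
          (ind (e ∈ S) * ind (EscapesBeyond G (ballSet G o (R + 1 + k)) T C e S)) :=
        expect_mono hq0 hq1 fun S _ => ind_escapes_le_sum ho hTB' hE'sub S
      _ = ∑ C ∈ T.powerset, ∑ e ∈ E', expect q E' fun S => ind (ClusterEq G T o C S) *
          (ind (e ∈ S) * ind (EscapesBeyond G (ballSet G o (R + 1 + k)) T C e S)) := by
        rw [expect_sum]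
        exact Finset.sum_congr rfl fun C _ => expect_sum _ _ _ _
      _ ≤ ∑ C ∈ T.powerset, ∑ e ∈ E', q * escapeProb G q o k *
          expect q E' fun S => ind (ClusterEq G T o C S) *
            ind (∃ x y, e = s(x, y) ∧ G.Adj x y ∧ x ∈ C ∧ y ∉ T) :=
        Finset.sum_le_sum fun C hC => Finset.sum_le_sum fun e he =>
          expect_escapesBeyond_le hlf htr hq0 hq1 hTB (Finset.mem_powerset.1 hC) he
      _ = q * escapeProb G q o k * ∑ e ∈ E', expect q E' fun S =>
          ∑ C ∈ T.powerset, ind (ClusterEq G T o C S) *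
            ind (∃ x y, e = s(x, y) ∧ G.Adj x y ∧ x ∈ C ∧ y ∉ T) := by
        rw [Finset.sum_comm, Finset.mul_sum]
        refine Finset.sum_congr rfl fun e _ => ?_
        rw [expect_sum, Finset.mul_sum]
      _ ≤ q * escapeProb G q o k * ∑ e ∈ E', expect q E' fun S =>
          ind (BoundaryLinked G T o e S) :=
        mul_le_mul_of_nonneg_left
          (Finset.sum_le_sum fun e _ => expect_mono hq0 hq1 fun S _ =>
            sum_cluster_le_boundaryLinked G T o e S)
          (mul_nonneg hq0 (escapeProb_nonneg hq0 hq1 G o k))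
      _ = q * X * escapeProb G q o k := by rw [hXE']; ring
  have hqX : 0 ≤ q * X := mul_nonneg hq0 hX0
  rcases hqX.eq_or_lt with h0 | hpos
  · have := step 0
    rw [← h0, zero_mul] at this
    linarith
  · have h1 : theta G q o / (q * X) ≤ theta G q o := by
      conv_rhs => rw [theta_eq]
      exact le_ciInf fun k => (div_le_iff₀' hpos).2 (step k)
    rw [div_le_iff₀ hpos] at h1
    exact le_of_mul_le_mul_left (by linarith) hθ

/-- Closed pivotal edges, counted on each possible value of the set of trapped vertices. -/
lemma sum_trapped_le_pivotal {G : SimpleGraph V} {B : Set V} (P : Finset (Finset V)) {o : V}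
    (hP : ∀ T ∈ P, o ∈ T) (E S : Finset (Sym2 V)) [DecidableEq (Sym2 V)] :
    ∑ T ∈ P, ∑ e ∈ E, ind (TrappedEq G B T S) * ind (BoundaryLinked G T o e S) ≤
      ∑ e ∈ E, ind (e ∉ S) * (ind (Escapes G B o (insert e S)) - ind (Escapes G B o S)) := by
  rw [Finset.sum_comm]
  refine Finset.sum_le_sum fun e _ => ?_
  have hrhs : ind (e ∉ S ∧ Escapes G B o (insert e S) ∧ ¬ Escapes G B o S) ≤
      ind (e ∉ S) * (ind (Escapes G B o (insert e S)) - ind (Escapes G B o S)) := by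
    by_cases h : e ∉ S ∧ Escapes G B o (insert e S) ∧ ¬ Escapes G B o S
    · rw [ind_of h, ind_of h.1, ind_of h.2.1, ind_of_not h.2.2]; norm_num
    · rw [ind_of_not h]
      exact mul_nonneg (ind_nonneg _)
        (sub_nonneg.2 (monotone_escapes G B o (Finset.subset_insert e S)))
  refine le_trans ?_ hrhs
  simp only [ind_mul]
  refine sum_ind_le _ _ _ (fun T _ T' _ h h' => ?_) fun T hT h => ?_
  · ext x
    rw [h.1 x, h'.1 x]
  · obtain ⟨hU, x, y, rfl, hxy, hx, hy, hl⟩ := h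
    obtain ⟨z, hz, hyz⟩ : Escapes G B y S := by
      by_contra hne
      exact hy ((hU y).2 hne)
    refine ⟨fun hS => (hU x).1 hx ⟨z, hz, Relation.ReflTransGen.head ⟨hxy, hS⟩ hyz⟩,
      ⟨z, hz, ?_⟩, (hU o).1 (hP T hT)⟩
    have h1 : Linked G (insert s(x, y) S : Finset (Sym2 V)) o x :=
      hl.mono (Set.inter_subset_left.trans (Finset.coe_subset.2 (Finset.subset_insert _ _)))
    have h2 : Linked G (insert s(x, y) S : Finset (Sym2 V)) y z :=
      hyz.mono (Finset.coe_subset.2 (Finset.subset_insert _ _))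
    exact (Relation.ReflTransGen.tail h1 ⟨hxy, by simp⟩).trans h2

/-- The Duminil-Copin–Tassion differential inequality, in integrated form. -/
lemma one_sub_exp_le_escapeProb {G : SimpleGraph V} (hlf : ∀ v, (G.neighborSet v).Finite)
    (htr : IsTransitive G) {q p : ℝ} (hq0 : 0 ≤ q) (hqp : q ≤ p) (hp1 : p ≤ 1) {o : V}
    (hθ : 0 < theta G q o) (R : ℕ) : 1 - Real.exp (-(p - q)) ≤ escapeProb G p o R := by
  classical
  set B := ballSet G o R with hB
  have hBfin : B.Finite := finite_ballSet hlf o R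
  set E := (finite_touching hlf hBfin).toFinset with hEdef
  have hE : touching B ∩ G.edgeSet ⊆ E := by simp [hEdef]
  set f : ℝ → ℝ := fun s => expect s E fun S => ind (Escapes G B o S) with hf
  set f' : ℝ → ℝ := fun s => ∑ e ∈ E, expect s (E.erase e) fun S =>
    ind (Escapes G B o (insert e S)) - ind (Escapes G B o S) with hf'
  have hderiv : ∀ s, HasDerivAt f (f' s) s := fun s => hasDerivAt_expect s E fun S => ind (Escapes G B o S)
  have hf01 : ∀ s, 0 ≤ s → s ≤ 1 → 0 ≤ f s ∧ f s ≤ 1 := by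
    intro s hs0 hs1
    constructor
    · rw [← expect_const s 0 E]
      exact expect_mono hs0 hs1 fun S _ => ind_nonneg _
    · rw [← expect_const s 1 E]
      exact expect_mono hs0 hs1 fun S _ => ind_le_one _
  set P := hBfin.toFinset.powerset.filter (o ∈ ·) with hPdef
  have hP : ∀ T ∈ P, o ∈ T := fun T hT => (Finset.mem_filter.1 hT).2
  have hPB : ∀ T ∈ P, (T : Set V) ⊆ B := fun T hT x hx =>
    hBfin.mem_toFinset.1 (Finset.mem_powerset.1 (Finset.mem_filter.1 hT).1 hx)
  have hineq : ∀ s, q ≤ s → s < 1 → 1 - f s ≤ f' s := by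
    intro s hqs hs1
    have hs0 : 0 ≤ s := hq0.trans hqs
    have hφ : ∀ T ∈ P, 1 ≤ ∑ e ∈ E, expect s E fun S => ind (BoundaryLinked G T o e S) := by
      intro T hT
      have h1 := one_le_of_theta_pos hlf htr hq0 (hqp.trans hp1) hθ (hP T hT) (hPB T hT) hE
      have h2 : ∑ e ∈ E, expect q E (fun S => ind (BoundaryLinked G T o e S)) ≤
          ∑ e ∈ E, expect s E fun S => ind (BoundaryLinked G T o e S) :=
        Finset.sum_le_sum fun e _ =>
          expect_mono_param hq0 hqs hs1.le E (monotone_boundaryLinked G T o e)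
      have h3 : 0 ≤ ∑ e ∈ E, expect q E (fun S => ind (BoundaryLinked G T o e S)) :=
        Finset.sum_nonneg fun e _ => by
          rw [← expect_const q 0 E]
          exact expect_mono hq0 (hqp.trans hp1) fun S _ => ind_nonneg _
      nlinarith
    have hmain : 1 - f s ≤ (1 - s) * f' s := by
      calc 1 - f s = expect s E fun S => 1 - ind (Escapes G B o S) := by
            rw [expect_sub, expect_const]
        _ ≤ expect s E fun S => ∑ T ∈ P, ind (TrappedEq G B T S) := by
            refine expect_mono hs0 hs1.le fun S _ => ?_
            have hnn : ∀ T ∈ P, 0 ≤ ind (TrappedEq G B T S) := fun T _ => ind_nonneg _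
            by_cases h : Escapes G B o S
            · rw [ind_of h, sub_self]
              exact Finset.sum_nonneg hnn
            · set T := hBfin.toFinset.filter fun x => ¬ Escapes G B x S with hT
              have hoB : o ∈ B := inBall_self G o R
              have hTP : T ∈ P := Finset.mem_filter.2
                ⟨Finset.mem_powerset.2 (Finset.filter_subset _ _),
                  Finset.mem_filter.2 ⟨hBfin.mem_toFinset.2 hoB, h⟩⟩
              have hTr : TrappedEq G B T S := by
                intro x
                rw [hT, Finset.mem_filter, hBfin.mem_toFinset]
                refine ⟨fun h => h.2, fun h => ⟨?_, h⟩⟩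
                by_contra hx
                exact h ⟨x, hx, Relation.ReflTransGen.refl⟩
              rw [ind_of_not h, sub_zero, ← ind_of hTr]
              exact Finset.single_le_sum (f := fun T => ind (TrappedEq G B T S)) hnn hTP
        _ = ∑ T ∈ P, expect s E fun S => ind (TrappedEq G B T S) := expect_sum _ _ _ _
        _ ≤ ∑ T ∈ P, (expect s E fun S => ind (TrappedEq G B T S)) *
              ∑ e ∈ E, expect s E fun S => ind (BoundaryLinked G T o e S) := by
            refine Finset.sum_le_sum fun T hT => le_mul_of_one_le_right ?_ (hφ T hT)
            rw [← expect_const s 0 E]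
            exact expect_mono hs0 hs1.le fun S _ => ind_nonneg _
        _ = expect s E fun S => ∑ T ∈ P, ∑ e ∈ E,
              ind (TrappedEq G B T S) * ind (BoundaryLinked G T o e S) := by
            rw [expect_sum]
            refine Finset.sum_congr rfl fun T _ => ?_
            rw [expect_sum, Finset.mul_sum]
            refine Finset.sum_congr rfl fun e _ => ?_
            refine (expect_mul_of_disjoint s E ?_ (dependsOnly_trappedEq G B T)
              (dependsOnly_boundaryLinked G T o e)).symm
            exact Set.disjoint_left.2 fun e he he' => he he'.1
        _ ≤ expect s E fun S => ∑ e ∈ E, ind (e ∉ S) *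
              (ind (Escapes G B o (insert e S)) - ind (Escapes G B o S)) :=
            expect_mono hs0 hs1.le fun S _ => sum_trapped_le_pivotal P hP E S
        _ = (1 - s) * f' s := by
            rw [expect_sum, hf', Finset.mul_sum]
            exact Finset.sum_congr rfl fun e he => (expect_erase s he _).symm
    have h0 : 0 ≤ 1 - f s := sub_nonneg.2 (hf01 s hs0 hs1.le).2
    have h1 : 0 ≤ f' s := by
      by_contra hneg
      nlinarith
    nlinarith
  have hg : ∀ s, HasDerivAt (fun s => (1 - f s) * Real.exp s)
      (-(f' s) * Real.exp s + (1 - f s) * Real.exp s) s :=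
    fun s => ((hderiv s).const_sub 1).mul (Real.hasDerivAt_exp s)
  have hanti : AntitoneOn (fun s => (1 - f s) * Real.exp s) (Set.Icc q p) := by
    refine antitoneOn_of_deriv_nonpos (convex_Icc q p)
      (fun s _ => (hg s).continuousAt.continuousWithinAt)
      (fun s _ => (hg s).differentiableAt.differentiableWithinAt) fun s hs => ?_
    rw [interior_Icc] at hs
    rw [(hg s).deriv]
    have := hineq s hs.1.le (hs.2.trans_le hp1)
    nlinarith [Real.exp_pos s]
  have h1 : (1 - f p) * Real.exp p ≤ (1 - f q) * Real.exp q :=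
    hanti (Set.left_mem_Icc.2 hqp) (Set.right_mem_Icc.2 hqp) hqp
  have h2 : (1 - f q) * Real.exp q ≤ Real.exp q :=
    mul_le_of_le_one_left (Real.exp_pos q).le (by linarith [(hf01 q hq0 (hqp.trans hp1)).1])
  have h3 : Real.exp q = Real.exp (-(p - q)) * Real.exp p := by
    rw [← Real.exp_add]; ring_nf
  have h4 : 1 - f p ≤ Real.exp (-(p - q)) :=
    le_of_mul_le_mul_right (h3 ▸ h1.trans h2) (Real.exp_pos p)
  rw [escapeProb_eq_expect (hq0.trans hqp) hp1 G o R hE]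
  linarith

lemma pc_le_one_of_infinite {G : SimpleGraph V} (hlf : ∀ v, (G.neighborSet v).Finite)
    (hconn : G.Connected) [Infinite V] : pc G ≤ 1 :=
  csInf_le ⟨0, fun _ h => h.1⟩
    ⟨zero_le_one, le_rfl, Classical.arbitrary V, theta_one_pos hlf hconn _⟩

/-- Above the critical point, the escape probabilities are bounded below uniformly in the graph. -/
lemma escapeProb_lower_bound {G : SimpleGraph V} (hlf : ∀ v, (G.neighborSet v).Finite)
    (htr : IsTransitive G) (hconn : G.Connected) [Infinite V] {p η : ℝ} (hη : 0 < η)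
    (hp : pc G + 2 * η ≤ p) (hp1 : p ≤ 1) (R : ℕ) :
    0 ≤ p ∧ ∃ v, 1 - Real.exp (-η) ≤ escapeProb G p v R := by
  obtain ⟨q, ⟨hq0, -, v, hθ⟩, hq⟩ := exists_lt_of_csInf_lt
    (s := {p : ℝ | 0 ≤ p ∧ p ≤ 1 ∧ ∃ v : V, 0 < theta G p v})
    ⟨1, zero_le_one, le_rfl, Classical.arbitrary V, theta_one_pos hlf hconn _⟩
    (show pc G < pc G + η by linarith)
  refine ⟨by linarith, v, le_trans ?_
    (one_sub_exp_le_escapeProb hlf htr hq0 (by linarith) hp1 hθ R)⟩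
  have : Real.exp (-(p - q)) ≤ Real.exp (-η) := Real.exp_le_exp.2 (by linarith)
  linarith

end Sharpness

/-- Lemma 5 of the paper, lower bound.  In the setting of the locality
theorem, for every `ε > 0` and `ε₁ > 0` there is `N` such that
`p_c(H) ≤ p_c(G n) + 2ε + ε₁` for all `n ≥ N`. -/
theorem pc_lower_bound
    {Vn : ℕ → Type*} {W : Type*} (G : ∀ n, SimpleGraph (Vn n)) (H : SimpleGraph W)
    (hGconn : ∀ n, (G n).Connected) (hGinf : ∀ n, Infinite (Vn n))
    (hGlf : ∀ n, ∀ v : Vn n, ((G n).neighborSet v).Finite)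
    (hGtrans : ∀ n, IsTransitive (G n))
    (hunif : ∃ c : ℝ, 0 < c ∧ ∀ n, c ≤ lambda1 (G n))
    (hHconn : H.Connected) (hHinf : Infinite W)
    (hHlf : ∀ w : W, (H.neighborSet w).Finite) (hHtrans : IsTransitive H)
    (d : ℕ) (hHreg : ∀ w : W, (H.neighborSet w).ncard = d)
    (hconv : ConvergesLocally G H)
    (hA1 : Assumption1i H d) (hA2 : Assumption1ii H) :
    ∀ ε ε₁ : ℝ, 0 < ε → 0 < ε₁ →
      ∃ N : ℕ, ∀ n, N ≤ n → pc H ≤ pc (G n) + 2 * ε + ε₁ := by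
  intro ε ε₁ hε hε₁
  by_contra! hcon
  set η := (2 * ε + ε₁) / 3 with hη
  have hη0 : 0 < η := by positivity
  have hpc1 : pc H ≤ 1 := pc_le_one_of_infinite hHlf hHconn
  obtain ⟨w⟩ : Nonempty W := inferInstance
  have key : ∀ R, 0 ≤ pc H - η ∧ 1 - Real.exp (-η) ≤ escapeProb H (pc H - η) w R := by
    intro R
    obtain ⟨N, hN⟩ := hconv (R + 1)
    obtain ⟨n, hn, hlt⟩ := hcon N
    obtain ⟨h0, v, hv⟩ := escapeProb_lower_bound (hGlf n) (hGtrans n) (hGconn n) hη0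
      (p := pc H - η) (by linarith) (by linarith) R
    exact ⟨h0, hv.trans
      (escapeProb_le_of_ballIso (hGlf n) h0 (by linarith) (hN n hn v w))⟩
  have hθ : 1 - Real.exp (-η) ≤ theta H (pc H - η) w := by
    rw [theta_eq]
    exact le_ciInf fun R => (key R).2
  have hexp : Real.exp (-η) < 1 := Real.exp_zero ▸ Real.exp_lt_exp.2 (by linarith)
  have : pc H ≤ pc H - η :=
    csInf_le ⟨0, fun _ h => h.1⟩ ⟨(key 0).1, by linarith, w, by linarith⟩
  linarith

end Loc
end

section
/- Let X = (X_t)_{t≥0} be a reversible irreducible Markov chain on a countable state space V with transition matrix P and stationary measure π of infinite total mass, and suppose that the bottom of the spectrum of I − P on ℓ²(V,π) equals λ₁ > 0. Let A ⊆ V be nonempty with π(A) < ∞, and let π_A(·) = π(A ∩ ·)/π(A). Then the probability, when X₀ is distributed according to π_A, that X_t ∉ A for all t ≥ 1 (i.e., the chain never returns to A) is at least λ₁. -/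
/-!
Statement 3 (Lemma 2 of the paper, from Benjamini–Nachmias–Peres): for a reversible
irreducible Markov chain with infinite stationary measure and spectral gap `λ₁ > 0`,
started from the normalized restriction of the stationary measure to a set `A` of
finite measure, the probability of never returning to `A` is at least `λ₁`.

The probability of returning to `A` is expressed combinatorially, as the (countable)
sum over all finite trajectories that start in `A`, stay outside `A` strictly in
between, and end in `A`, of their weights; the never-return probability is then
`1` minus this sum.
-/

namespace MC

variable {V : Type*}

/-- The product of the one-step transition probabilities along a finite trajectory. -/
noncomputable def pathWeight (P : V → V → ℝ) : List V → ℝ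
  | [] => 1
  | [_] => 1
  | x :: y :: l => P x y * pathWeight P (y :: l)

/-- `l` is a trajectory `x₀, x₁, …, x_t` with `t ≥ 1`, `x₀ ∈ A`, `x_t ∈ A`, and
`x_i ∉ A` for `0 < i < t`: a first-return-to-`A` trajectory. -/
def IsFirstReturn (A : Set V) (l : List V) : Prop :=
  2 ≤ l.length ∧ (∀ x, l.head? = some x → x ∈ A) ∧ (∀ x, l.getLast? = some x → x ∈ A) ∧
    ∀ i (h : i < l.length), 0 < i → i + 1 < l.length → l.get ⟨i, h⟩ ∉ A

/-- The weight of the starting point of a trajectory under the initial distribution `ν`. -/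
noncomputable def startWeight (ν : V → ℝ) : List V → ℝ
  | [] => 0
  | x :: _ => ν x

/-- The probability that the chain with transition matrix `P` and initial distribution `ν`
returns to `A` at some time `t ≥ 1`: the sum over all first-return trajectories of their
weights. -/
noncomputable def returnProb (P : V → V → ℝ) (ν : V → ℝ) (A : Set V) : ℝ :=
  ∑' l : {l : List V // IsFirstReturn A l}, startWeight ν l.1 * pathWeight P l.1

/-- `l` is a trajectory ending in `A` whose earlier points all lie outside `A`. -/
def IsFirstHit (A : Set V) : List V → Prop
  | [] => False
  | [x] => x ∈ A
  | x :: y :: l => x ∉ A ∧ IsFirstHit A (y :: l)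

/-- One step of the chain, acting on functions. -/
noncomputable def step (P : V → V → ℝ) (f : V → ℝ) (x : V) : ℝ := ∑' y, P x y * f y

open Classical in
/-- The probability that the chain started at a point visits `A` at a time at most `n`. -/
noncomputable def hitProb (P : V → V → ℝ) (A : Set V) : ℕ → V → ℝ
  | 0 => A.indicator 1
  | n + 1 => fun x => if x ∈ A then 1 else step P (hitProb P A n) x

lemma isFirstHit_of_forall_get {A : Set V} {l : List V} (hne : l ≠ [])
    (hlast : ∀ x, l.getLast? = some x → x ∈ A)
    (h : ∀ i (hi : i < l.length), i + 1 < l.length → l.get ⟨i, hi⟩ ∉ A) : IsFirstHit A l := by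
  induction l with
  | nil => exact hne rfl
  | cons x l ih =>
    cases l with
    | nil => exact hlast x rfl
    | cons y l =>
      refine ⟨h 0 (by simp) (by simp), ih (by simp) (fun z hz => hlast z ?_) fun i hi hi' => ?_⟩
      · simpa [List.getLast?_cons_cons] using hz
      · exact h (i + 1) (by simpa using hi) (by simpa using hi')

lemma IsFirstReturn.mem_and_isFirstHit {A : Set V} {x : V} {m : List V}
    (h : IsFirstReturn A (x :: m)) : x ∈ A ∧ IsFirstHit A m := by
  obtain ⟨h1, h2, h3, h4⟩ := h
  cases m with
  | nil => simp at h1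
  | cons y m =>
    refine ⟨h2 x rfl, isFirstHit_of_forall_get (by simp) (fun z hz => h3 z ?_)
      fun i hi hi' => ?_⟩
    · simpa [List.getLast?_cons_cons] using hz
    · exact h4 (i + 1) (by simpa using hi) (by omega) (by simpa using hi')

lemma sum_lists_le_tsum [Nonempty V] {S : Finset (List V)} {g : List V → ℝ} {c : V → ℝ}
    (hc : Summable c) (hc0 : ∀ y, 0 ≤ c y) (hnil : [] ∉ S)
    (h : ∀ y (T : Finset (List V)), (∀ m ∈ T, y :: m ∈ S) → ∑ m ∈ T, g (y :: m) ≤ c y) :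
    ∑ l ∈ S, g l ≤ ∑' y, c y := by
  classical
  let d : V := Classical.arbitrary V
  have hcons : ∀ l ∈ S, l.headD d :: l.tail = l := by
    intro l hl
    cases l with
    | nil => exact absurd hl hnil
    | cons y m => rfl
  rw [← Finset.sum_fiberwise_of_maps_to (t := S.image (·.headD d))
    (fun l hl => Finset.mem_image_of_mem _ hl)]
  refine le_trans (Finset.sum_le_sum fun y _ => ?_) (hc.sum_le_tsum _ fun y _ => hc0 y)
  have key : ∀ l ∈ S.filter (fun l => l.headD d = y), y :: l.tail = l := by
    intro l hl
    obtain ⟨hlS, rfl⟩ := Finset.mem_filter.1 hl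
    exact hcons l hlS
  have hinj : Set.InjOn List.tail (S.filter (fun l => l.headD d = y) : Set (List V)) := by
    intro a ha b hb hab
    rw [← key a ha, ← key b hb]
    exact congrArg _ hab
  have := h y ((S.filter fun l => l.headD d = y).image List.tail) (by
    intro m hm
    obtain ⟨l, hl, rfl⟩ := Finset.mem_image.1 hm
    rw [key l hl]
    exact (Finset.mem_filter.1 hl).1)
  rw [Finset.sum_image hinj] at this
  refine le_trans (le_of_eq (Finset.sum_congr rfl fun l hl => ?_)) this
  rw [key l hl]

lemma summable_row {P : V → V → ℝ} (hProw : ∀ x, ∑' y, P x y = 1) (x : V) :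
    Summable (P x) := by
  by_contra h
  simpa [tsum_eq_zero_of_not_summable h] using hProw x

lemma summable_row_mul {P : V → V → ℝ} (hP0 : ∀ x y, 0 ≤ P x y)
    (hProw : ∀ x, ∑' y, P x y = 1)
    {f : V → ℝ} (h0 : ∀ x, 0 ≤ f x) (h1 : ∀ x, f x ≤ 1) (x : V) :
    Summable fun y => P x y * f y :=
  (summable_row hProw x).of_nonneg_of_le (fun y => mul_nonneg (hP0 x y) (h0 y))
    fun y => mul_le_of_le_one_right (hP0 x y) (h1 y)

lemma step_nonneg {P : V → V → ℝ} (hP0 : ∀ x y, 0 ≤ P x y)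
    {f : V → ℝ} (h0 : ∀ x, 0 ≤ f x) (x : V) : 0 ≤ step P f x :=
  tsum_nonneg fun y => mul_nonneg (hP0 x y) (h0 y)

lemma step_le_one {P : V → V → ℝ} (hP0 : ∀ x y, 0 ≤ P x y)
    (hProw : ∀ x, ∑' y, P x y = 1)
    {f : V → ℝ} (h0 : ∀ x, 0 ≤ f x) (h1 : ∀ x, f x ≤ 1) (x : V) : step P f x ≤ 1 := by
  rw [← hProw x]
  exact (summable_row_mul hP0 hProw h0 h1 x).tsum_le_tsum
    (fun y => mul_le_of_le_one_right (hP0 x y) (h1 y)) (summable_row hProw x)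

lemma hitProb_mem_Icc {P : V → V → ℝ} (hP0 : ∀ x y, 0 ≤ P x y)
    (hProw : ∀ x, ∑' y, P x y = 1)
    (A : Set V) (n : ℕ) (x : V) : 0 ≤ hitProb P A n x ∧ hitProb P A n x ≤ 1 := by
  induction n generalizing x with
  | zero => by_cases hx : x ∈ A <;> simp [hitProb, hx]
  | succ n ih =>
    by_cases hx : x ∈ A
    · simp [hitProb, hx]
    · simpa [hitProb, hx] using ⟨step_nonneg hP0 (fun y => (ih y).1) x,
        step_le_one hP0 hProw (fun y => (ih y).1) (fun y => (ih y).2) x⟩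

lemma hitProb_of_mem (P : V → V → ℝ) {A : Set V} {x : V} (hx : x ∈ A) (n : ℕ) :
    hitProb P A n x = 1 := by
  cases n <;> simp [hitProb, hx]

lemma hitProb_succ_of_notMem (P : V → V → ℝ) {A : Set V} {x : V} (hx : x ∉ A) (n : ℕ) :
    hitProb P A (n + 1) x = step P (hitProb P A n) x := by
  simp [hitProb, hx]

lemma hitProb_le_succ {P : V → V → ℝ} (hP0 : ∀ x y, 0 ≤ P x y)
    (hProw : ∀ x, ∑' y, P x y = 1)
    (A : Set V) (n : ℕ) (x : V) : hitProb P A n x ≤ hitProb P A (n + 1) x := by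
  induction n generalizing x with
  | zero =>
    by_cases hx : x ∈ A
    · simp [hitProb_of_mem P hx]
    · simpa [hitProb, hx] using (hitProb_mem_Icc hP0 hProw A 1 x).1
  | succ n ih =>
    by_cases hx : x ∈ A
    · simp [hitProb_of_mem P hx]
    · rw [hitProb_succ_of_notMem P hx, hitProb_succ_of_notMem P hx]
      have hI := hitProb_mem_Icc hP0 hProw A
      exact (summable_row_mul hP0 hProw (fun y => (hI n y).1) (fun y => (hI n y).2) x).tsum_le_tsum
        (fun y => mul_le_mul_of_nonneg_left (ih y) (hP0 x y))
        (summable_row_mul hP0 hProw (fun y => (hI (n + 1) y).1) (fun y => (hI (n + 1) y).2) x)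

/-- The hitting probability dominates the weight of any finite set of hitting trajectories. -/
lemma sum_pathWeight_le_hitProb {P : V → V → ℝ} (hP0 : ∀ x y, 0 ≤ P x y)
    (hProw : ∀ x, ∑' y, P x y = 1)
    (A : Set V) (n : ℕ) (x : V) (S : Finset (List V))
    (hS : ∀ m ∈ S, IsFirstHit A (x :: m) ∧ m.length ≤ n) :
    ∑ m ∈ S, pathWeight P (x :: m) ≤ hitProb P A n x := by
  have hI := hitProb_mem_Icc hP0 hProw A
  induction n generalizing x S with
  | zero =>
    have hnil : ∀ m ∈ S, m = [] := fun m hm =>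
      List.eq_nil_of_length_eq_zero (Nat.le_zero.1 (hS m hm).2)
    rcases Finset.subset_singleton_iff.1 (fun m hm => Finset.mem_singleton.2 (hnil m hm) :
      S ⊆ {[]}) with rfl | rfl
    · simpa using (hI 0 x).1
    · have hx : x ∈ A := (hS [] (by simp)).1
      simp [hitProb_of_mem P hx, pathWeight]
  | succ n ih =>
    by_cases hx : x ∈ A
    · have hnil : ∀ m ∈ S, m = [] := by
        intro m hm
        cases m with
        | nil => rfl
        | cons y m => exact absurd hx (hS _ hm).1.1
      rw [hitProb_of_mem P hx]
      rcases Finset.subset_singleton_iff.1 (fun m hm => Finset.mem_singleton.2 (hnil m hm) :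
        S ⊆ {[]}) with rfl | rfl <;> simp [pathWeight]
    · have : Nonempty V := ⟨x⟩
      rw [hitProb_succ_of_notMem P hx]
      refine sum_lists_le_tsum
        (summable_row_mul hP0 hProw (fun y => (hI n y).1) (fun y => (hI n y).2) x)
        (fun y => mul_nonneg (hP0 x y) (hI n y).1) (fun h => hx (hS _ h).1) ?_
      intro y T hT
      simp only [pathWeight, ← Finset.mul_sum]
      refine mul_le_mul_of_nonneg_left (ih y T fun m hm => ?_) (hP0 x y)
      obtain ⟨h1, h2⟩ := hS _ (hT m hm)
      exact ⟨h1.2, by simpa using h2⟩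

/-- A reversible chain preserves summability against its stationary measure. -/
lemma summable_step {P : V → V → ℝ} (hP0 : ∀ x y, 0 ≤ P x y)
    (hProw : ∀ x, ∑' y, P x y = 1)
    {π : V → ℝ} (hπ0 : ∀ x, 0 ≤ π x) (hrev : ∀ x y, π x * P x y = π y * P y x)
    {f : V → ℝ} (h0 : ∀ x, 0 ≤ f x) (hf : Summable fun x => f x * π x) :
    Summable fun x => step P f x * π x := by
  have hs : Summable fun p : V × V => π p.1 * f p.1 * P p.1 p.2 := by
    have hnonneg : 0 ≤ fun p : V × V => π p.1 * f p.1 * P p.1 p.2 :=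
      Pi.le_def.2 fun p => mul_nonneg (mul_nonneg (hπ0 p.1) (h0 p.1)) (hP0 p.1 p.2)
    refine (summable_prod_of_nonneg hnonneg).2
      ⟨fun x => (summable_row hProw x).mul_left (π x * f x), ?_⟩
    simp only [tsum_mul_left, hProw, mul_one]
    exact hf.congr fun x => mul_comm _ _
  have hs' : Summable fun p : V × V => π p.2 * f p.2 * P p.2 p.1 := hs.prod_symm
  refine hs'.prod.congr fun x => ?_
  rw [step, ← tsum_mul_right]
  refine tsum_congr fun y => ?_
  linear_combination (-f y) * hrev x y

lemma summable_hitProb {P : V → V → ℝ} (hP0 : ∀ x y, 0 ≤ P x y)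
    (hProw : ∀ x, ∑' y, P x y = 1)
    {π : V → ℝ} (hπ0 : ∀ x, 0 ≤ π x) (hrev : ∀ x y, π x * P x y = π y * P y x)
    {A : Set V} (hA : Summable (A.indicator π)) (n : ℕ) :
    Summable fun x => hitProb P A n x * π x := by
  have hI := hitProb_mem_Icc hP0 hProw A
  induction n with
  | zero =>
    refine hA.congr fun x => ?_
    by_cases hx : x ∈ A <;> simp [hitProb, hx]
  | succ n ih =>
    refine (hA.add (summable_step hP0 hProw hπ0 hrev (fun x => (hI n x).1) ih)).of_nonneg_of_le
      (fun x => mul_nonneg (hI _ x).1 (hπ0 x)) fun x => ?_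
    by_cases hx : x ∈ A
    · simpa [hitProb_of_mem P hx, hx] using
        mul_nonneg (step_nonneg hP0 (fun x => (hI n x).1) x) (hπ0 x)
    · simp [hitProb_succ_of_notMem P hx, hx]

/-- The spectral inequality bounds the stationary flow of return trajectories. -/
lemma tsum_indicator_mul_step_hitProb_le {P : V → V → ℝ} (hP0 : ∀ x y, 0 ≤ P x y)
    (hProw : ∀ x, ∑' y, P x y = 1)
    {π : V → ℝ} (hπ0 : ∀ x, 0 ≤ π x) (hrev : ∀ x y, π x * P x y = π y * P y x)
    {lam : ℝ} (hlam : 0 ≤ lam)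
    (hspec : ∀ f : V → ℝ, Summable (fun x => f x ^ 2 * π x) →
      lam * (∑' x, f x ^ 2 * π x) ≤ ∑' x, (f x - ∑' y, P x y * f y) * f x * π x)
    {A : Set V} (hA : Summable (A.indicator π)) (n : ℕ) :
    ∑' x, A.indicator π x * step P (hitProb P A n) x ≤ (1 - lam) * ∑' x, A.indicator π x := by
  have hI := hitProb_mem_Icc hP0 hProw A
  set u := hitProb P A n with hu
  have hu0 : ∀ x, 0 ≤ u x := fun x => (hI n x).1
  have hu1 : ∀ x, u x ≤ 1 := fun x => (hI n x).2
  have hsu : Summable fun x => u x * π x := summable_hitProb hP0 hProw hπ0 hrev hA n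
  have hstep0 := step_nonneg hP0 hu0
  have hstep1 := step_le_one hP0 hProw hu0 hu1
  have hsq : Summable fun x => u x ^ 2 * π x :=
    hsu.of_nonneg_of_le (fun x => mul_nonneg (sq_nonneg _) (hπ0 x)) fun x =>
      mul_le_mul_of_nonneg_right (by nlinarith [hu0 x, hu1 x]) (hπ0 x)
  have hsstep : Summable fun x => step P u x * u x * π x :=
    hsu.of_nonneg_of_le
      (fun x => mul_nonneg (mul_nonneg (hstep0 x) (hu0 x)) (hπ0 x)) fun x =>
      mul_le_mul_of_nonneg_right (mul_le_of_le_one_left (hu0 x) (hstep1 x)) (hπ0 x)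
  have hind0 : ∀ x, 0 ≤ A.indicator π x := fun x => Set.indicator_nonneg (fun x _ => hπ0 x) x
  have hsA : Summable fun x => A.indicator π x * step P u x :=
    hA.of_nonneg_of_le (fun x => mul_nonneg (hind0 x) (hstep0 x)) fun x =>
      mul_le_of_le_one_right (hind0 x) (hstep1 x)
  have h1 : ∑' x, A.indicator π x ≤ ∑' x, u x ^ 2 * π x := by
    refine hA.tsum_le_tsum (fun x => ?_) hsq
    by_cases hx : x ∈ A
    · simp [hx, hu, hitProb_of_mem P hx]
    · simpa [hx] using mul_nonneg (sq_nonneg (u x)) (hπ0 x)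
  have h2 : ∑' x, (u x - step P u x) * u x * π x ≤
      ∑' x, (A.indicator π x - A.indicator π x * step P u x) := by
    refine Summable.tsum_le_tsum (fun x => ?_)
      ((hsq.sub hsstep).congr fun x => by ring) (hA.sub hsA)
    by_cases hx : x ∈ A
    · have : u x = 1 := hitProb_of_mem P hx n
      simp only [hx, Set.indicator_of_mem, this]
      exact le_of_eq (by ring)
    · have h : u x ≤ step P u x := by
        rw [hu, ← hitProb_succ_of_notMem P hx]
        exact hitProb_le_succ hP0 hProw A n x
      simp only [hx, not_false_eq_true, Set.indicator_of_notMem, zero_mul, sub_zero]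
      exact mul_nonpos_of_nonpos_of_nonneg
        (mul_nonpos_of_nonpos_of_nonneg (sub_nonpos.2 h) (hu0 x)) (hπ0 x)
  rw [hA.tsum_sub hsA] at h2
  have h3 : lam * (∑' x, u x ^ 2 * π x) ≤ ∑' x, (u x - step P u x) * u x * π x := hspec u hsq
  linarith [mul_le_mul_of_nonneg_left h1 hlam]

/-- Finite sums over first-return trajectories are bounded by finite-time return probabilities. -/
lemma exists_sum_le_tsum_step_hitProb [Nonempty V] {P : V → V → ℝ} (hP0 : ∀ x y, 0 ≤ P x y)
    (hProw : ∀ x, ∑' y, P x y = 1)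
    {ν : V → ℝ} {A : Set V} (hν0 : ∀ x, 0 ≤ ν x) (hν : Summable ν)
    (S : Finset (List V)) (hS : ∀ l ∈ S, IsFirstReturn A l) :
    ∃ n, ∑ l ∈ S, startWeight ν l * pathWeight P l ≤
      ∑' x, ν x * step P (hitProb P A n) x := by
  have hI := hitProb_mem_Icc hP0 hProw A
  set n := S.sup List.length
  have hlen : ∀ l ∈ S, l.length ≤ n := fun l hl => Finset.le_sup (f := List.length) hl
  have h0 : ∀ x, 0 ≤ step P (hitProb P A n) x := step_nonneg hP0 fun x => (hI n x).1
  have h1 : ∀ x, step P (hitProb P A n) x ≤ 1 :=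
    step_le_one hP0 hProw (fun x => (hI n x).1) fun x => (hI n x).2
  refine ⟨n, sum_lists_le_tsum ?_ (fun x => mul_nonneg (hν0 x) (h0 x)) ?_ ?_⟩
  · exact hν.of_nonneg_of_le (fun x => mul_nonneg (hν0 x) (h0 x)) fun x =>
      mul_le_of_le_one_right (hν0 x) (h1 x)
  · intro h
    simpa using (hS _ h).1
  · intro x T hT
    simp only [startWeight, ← Finset.mul_sum]
    refine mul_le_mul_of_nonneg_left ?_ (hν0 x)
    have hhit : ∀ m ∈ T, IsFirstHit A m := fun m hm => (hS _ (hT m hm)).mem_and_isFirstHit.2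
    refine sum_lists_le_tsum
      (summable_row_mul hP0 hProw (fun y => (hI n y).1) (fun y => (hI n y).2) x)
      (fun y => mul_nonneg (hP0 x y) (hI n y).1) (fun h => hhit _ h) fun y U hU => ?_
    simp only [pathWeight, ← Finset.mul_sum]
    refine mul_le_mul_of_nonneg_left
      (sum_pathWeight_le_hitProb hP0 hProw A n y U fun m hm => ⟨hhit _ (hU m hm), ?_⟩) (hP0 x y)
    have := hlen _ (hT _ (hU m hm))
    simp only [List.length_cons] at this
    omega

/-- Let `P` be a Markov transition matrix on a countable state space `V`,
reversible and irreducible with respect to a stationary measure `π` of infinite total mass,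
and let `λ₁ > 0` be the bottom of the spectrum of `I - P` on `ℓ²(V,π)`.  If `A` is a
nonempty set with `π(A) < ∞` and `π_A = π(A ∩ ·)/π(A)`, then the chain started from `π_A`
never returns to `A` with probability at least `λ₁`. -/
theorem never_return_prob_ge_lambda1 [Countable V]
    (P : V → V → ℝ) (π : V → ℝ) (lam : ℝ)
    (hP0 : ∀ x y, 0 ≤ P x y) (hProw : ∀ x, ∑' y, P x y = 1)
    (hπ0 : ∀ x, 0 ≤ π x)
    (hrev : ∀ x y, π x * P x y = π y * P y x)
    (hirr : ∀ x y : V, ∃ l : List V,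
      l.head? = some x ∧ l.getLast? = some y ∧ 0 < pathWeight P l)
    (hπinf : ¬ Summable π)
    (hspec : IsGreatest {c : ℝ | ∀ f : V → ℝ, Summable (fun x => f x ^ 2 * π x) →
      c * (∑' x, f x ^ 2 * π x) ≤ ∑' x, (f x - ∑' y, P x y * f y) * f x * π x} lam)
    (hlam : 0 < lam)
    (A : Set V) (hA : A.Nonempty) (hAfin : Summable fun x : A => π x) :
    lam ≤ 1 - returnProb P (fun x => A.indicator π x / ∑' a : A, π a) A := by
  obtain ⟨a, -⟩ := hA
  have : Nonempty V := ⟨a⟩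
  have hbound := fun {B : Set V} (hB : Summable (B.indicator π)) n =>
    tsum_indicator_mul_step_hitProb_le hP0 hProw hπ0 hrev hlam.le hspec.1 hB n
  have hind0 : ∀ (B : Set V) x, 0 ≤ B.indicator π x :=
    fun B x => Set.indicator_nonneg (fun x _ => hπ0 x) x
  have hlam1 : lam ≤ 1 := by
    obtain ⟨x, hx⟩ : ∃ x, π x ≠ 0 := by
      by_contra! h
      exact hπinf (by simp [funext h])
    have hsum : HasSum (({x} : Set V).indicator π) (π x) := by
      simpa using hasSum_single (f := ({x} : Set V).indicator π) x
        fun y hy => Set.indicator_of_notMem (s := {x}) hy π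
    have h := hbound hsum.summable 0
    rw [hsum.tsum_eq] at h
    have h' : 0 ≤ (1 - lam) * π x := le_trans (tsum_nonneg fun y => mul_nonneg (hind0 _ y)
      (step_nonneg hP0 (fun z => (hitProb_mem_Icc hP0 hProw _ 0 z).1) y)) h
    linarith [nonneg_of_mul_nonneg_left h' (lt_of_le_of_ne (hπ0 x) hx.symm)]
  have hA : Summable (A.indicator π) := summable_subtype_iff_indicator.1 hAfin
  rw [tsum_subtype A π]
  set M := ∑' x, A.indicator π x
  have hM0 : 0 ≤ M := tsum_nonneg (hind0 A)
  have hret : returnProb P (fun x => A.indicator π x / M) A ≤ 1 - lam := by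
    refine tsum_le_of_sum_le' (sub_nonneg.2 hlam1) fun S => ?_
    obtain ⟨n, hn⟩ := exists_sum_le_tsum_step_hitProb hP0 hProw (A := A)
      (ν := fun x => A.indicator π x / M) (fun x => div_nonneg (hind0 A x) hM0)
      (hA.div_const M) (S.map (Function.Embedding.subtype _)) (by
        intro l hl
        obtain ⟨m, -, rfl⟩ := Finset.mem_map.1 hl
        exact m.2)
    rw [Finset.sum_map] at hn
    refine hn.trans ?_
    simp only [div_mul_eq_mul_div, tsum_div_const]
    rcases hM0.eq_or_lt with h | h
    · simpa [← h] using hlam1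
    · exact (div_le_iff₀ h).2 (hbound hA n)
  linarith

end MC
end

section
/- Let Γ be a finitely generated group with finite symmetric generating set S not containing the identity, whose right Cayley graph H is nonamenable (equivalently ρ(H) < 1). Let r ∈ Γ, r ≠ e, and assume that either r has finite order, or r has infinite order and there is a constant c > 0 with |r^k| ≥ c·|k|·|r| for all k ∈ ℤ. For j ∈ ℕ set q_j = |{(s₁,…,s_j) ∈ S^j : s₁⋯s_j ∈ ⟨r⟩}| / |S|^j, the j-step return probability of the random walk projected to the left cosets of the cyclic subgroup ⟨r⟩. Then limsup_{j→∞} q_j^{1/j} = ρ(H); that is, the spectral radius of the coset (quotient) walk equals the spectral radius of H. -/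
/-!
Statement 5 (Lemma 1 of the paper): for a nonamenable Cayley graph `H` of a group `Γ`
and `r ∈ Γ` as in the hypotheses, the spectral radius of the simple random walk
projected to the left cosets of `⟨r⟩` equals the spectral radius `ρ(H)`.
-/

namespace Spec

variable {Γ : Type*} [Group Γ]

/-- The word length of `g` with respect to the generating set `S`. -/
noncomputable def wlen (S : Set Γ) (g : Γ) : ℕ :=
  sInf {n : ℕ | ∃ l : List Γ, (∀ s ∈ l, s ∈ S) ∧ l.length = n ∧ l.prod = g}

/-- `stepProb S j K`: the probability that a `j`-step word in the uniform generators `S`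
has product lying in `K`, i.e. `|{(s₁,…,s_j) ∈ S^j : s₁⋯s_j ∈ K}| / |S|^j`.
For `K = {1}` this is the `j`-step return probability `p_H^j(x,x)` of simple random walk
on the Cayley graph of `(Γ,S)`, and for `K = ⟨r⟩` it is the `j`-step return probability
of the walk projected to the left cosets of `⟨r⟩`. -/
noncomputable def stepProb (S : Finset Γ) (j : ℕ) (K : Set Γ) : ℝ :=
  (Nat.card {t : Fin j → Γ // (∀ i, t i ∈ S) ∧ (List.ofFn t).prod ∈ K} : ℝ) /
    (S.card : ℝ) ^ j

open Filter Topology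
open scoped Pointwise

/-- The words of length `j` in `S` whose product lies in `K`. -/
def words (S : Finset Γ) (j : ℕ) (K : Set Γ) : Set (Fin j → Γ) :=
  {t | (∀ i, t i ∈ S) ∧ (List.ofFn t).prod ∈ K}

lemma stepProb_eq (S : Finset Γ) (j : ℕ) (K : Set Γ) :
    stepProb S j K = ((words S j K).ncard : ℝ) / (S.card : ℝ) ^ j := rfl

lemma words_finite (S : Finset Γ) (j : ℕ) (K : Set Γ) : (words S j K).Finite :=
  (Set.Finite.pi' (fun _ : Fin j => S.finite_toSet)).subset fun _ ht => ht.1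

lemma stepProb_nonneg (S : Finset Γ) (j : ℕ) (K : Set Γ) : 0 ≤ stepProb S j K := by
  rw [stepProb_eq]; positivity

lemma stepProb_mono (S : Finset Γ) (j : ℕ) {K L : Set Γ} (h : K ⊆ L) :
    stepProb S j K ≤ stepProb S j L := by
  rw [stepProb_eq, stepProb_eq]
  gcongr
  · exact words_finite S j L
  · exact fun t ht => ⟨ht.1, h ht.2⟩

lemma stepProb_le_one (S : Finset Γ) (j : ℕ) (K : Set Γ) : stepProb S j K ≤ 1 := by
  classical
  rw [stepProb_eq]
  refine div_le_one_of_le₀ ?_ (by positivity)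
  have hsub : words S j K ⊆ (Fintype.piFinset fun _ : Fin j => S : Finset (Fin j → Γ)) := by
    intro t ht
    simpa using ht.1
  have h := Set.ncard_le_ncard hsub (Finset.finite_toSet _)
  rw [Set.ncard_coe_finset, Fintype.card_piFinset_const] at h
  exact_mod_cast h

lemma stepProb_zero_one (S : Finset Γ) : stepProb S 0 ({1} : Set Γ) = 1 := by
  have h : words S 0 ({1} : Set Γ) = {Fin.elim0} := by
    ext t
    simp [words, Subsingleton.elim t Fin.elim0]
  simp [stepProb_eq, h]

lemma stepProb_mul_le (S : Finset Γ) (m n : ℕ) (a b : Γ) :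
    stepProb S m {a} * stepProb S n {b} ≤ stepProb S (m + n) {a * b} := by
  simp only [stepProb_eq]
  rw [div_mul_div_comm, ← pow_add, ← Nat.cast_mul, ← Set.ncard_prod]
  gcongr
  refine Set.ncard_le_ncard_of_injOn (fun p => Fin.append p.1 p.2) ?_ ?_ (words_finite _ _ _)
  · rintro ⟨s, t⟩ ⟨⟨hs, hs'⟩, ht, ht'⟩
    refine ⟨fun i => ?_, ?_⟩
    · refine Fin.addCases (fun i => ?_) (fun i => ?_) i
      · simpa using hs i
      · simpa using ht i
    · simp only [Set.mem_singleton_iff] at hs' ht' ⊢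
      rw [List.ofFn_fin_append, List.prod_append, hs', ht']
  · rintro p - q - h
    exact (Fin.appendEquiv m n).injective h

lemma stepProb_le_inv (S : Finset Γ) (hsym : ∀ s ∈ S, s⁻¹ ∈ S) (j : ℕ) (g : Γ) :
    stepProb S j {g} ≤ stepProb S j {g⁻¹} := by
  simp only [stepProb_eq]
  refine div_le_div_of_nonneg_right (Nat.cast_le.mpr ?_) (by positivity)
  refine Set.ncard_le_ncard_of_injOn (fun (t : Fin j → Γ) i => (t i.rev)⁻¹) ?_ ?_ (words_finite _ _ _)
  · rintro t ⟨ht, ht'⟩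
    refine ⟨fun i => hsym _ (ht _), ?_⟩
    simp only [Set.mem_singleton_iff] at ht' ⊢
    have : List.ofFn (fun i : Fin j => (t i.rev)⁻¹)
        = ((List.ofFn t).map fun x => x⁻¹).reverse := by
      refine List.ext_getElem (by simp) fun i h1 h2 => ?_
      simp only [List.getElem_ofFn, List.getElem_reverse, List.getElem_map, List.length_map,
        List.length_ofFn]
      congr 2
      ext
      simp only [Fin.val_rev]
      omega
    rw [this, ← List.prod_inv_reverse, ht']
  · rintro s - t - h
    funext i
    simpa using congrFun h i.rev

lemma stepProb_sq_le (S : Finset Γ) (hsym : ∀ s ∈ S, s⁻¹ ∈ S) (j : ℕ) (g : Γ) :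
    stepProb S j {g} ^ 2 ≤ stepProb S (j + j) {1} := by
  calc stepProb S j {g} ^ 2 ≤ stepProb S j {g} * stepProb S j {g⁻¹} := by
        rw [sq]
        exact mul_le_mul_of_nonneg_left (stepProb_le_inv S hsym j g) (stepProb_nonneg _ _ _)
    _ ≤ stepProb S (j + j) {1} := by simpa using stepProb_mul_le S j j g g⁻¹

lemma stepProb_one_pow_le (S : Finset Γ) (n m : ℕ) :
    stepProb S n {1} ^ m ≤ stepProb S (n * m) ({1} : Set Γ) := by
  induction m with
  | zero => simp [stepProb_zero_one]
  | succ m ih =>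
    calc stepProb S n {1} ^ (m + 1) = stepProb S n {1} ^ m * stepProb S n {1} := pow_succ _ _
      _ ≤ stepProb S (n * m) {1} * stepProb S n {1} :=
        mul_le_mul_of_nonneg_right ih (stepProb_nonneg _ _ _)
      _ ≤ stepProb S (n * (m + 1)) {1} := by
        simpa [Nat.mul_succ] using stepProb_mul_le S (n * m) n 1 1

lemma stepProb_rpow_le_one (S : Finset Γ) (K : Set Γ) (j : ℕ) :
    stepProb S j K ^ ((j : ℝ))⁻¹ ≤ 1 :=
  Real.rpow_le_one (stepProb_nonneg _ _ _) (stepProb_le_one _ _ _) (by positivity)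

lemma isBoundedUnder_stepProb_rpow (S : Finset Γ) (K : Set Γ) :
    IsBoundedUnder (· ≤ ·) atTop fun j : ℕ => stepProb S j K ^ ((j : ℝ))⁻¹ :=
  isBoundedUnder_of ⟨1, stepProb_rpow_le_one S K⟩

lemma isCoboundedUnder_stepProb_rpow (S : Finset Γ) (K : Set Γ) :
    IsCoboundedUnder (· ≤ ·) atTop fun j : ℕ => stepProb S j K ^ ((j : ℝ))⁻¹ :=
  (isBoundedUnder_of ⟨0, fun j => Real.rpow_nonneg (stepProb_nonneg S j K) _⟩ :
    IsBoundedUnder (· ≥ ·) atTop _).isCoboundedUnder_le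

/-- The spectral radius of the simple random walk. -/
noncomputable def specRadius (S : Finset Γ) : ℝ :=
  limsup (fun j : ℕ => stepProb S j ({1} : Set Γ) ^ ((j : ℝ))⁻¹) atTop

lemma stepProb_one_rpow_le_specRadius (S : Finset Γ) {n : ℕ} (hn : n ≠ 0) :
    stepProb S n ({1} : Set Γ) ^ ((n : ℝ))⁻¹ ≤ specRadius S := by
  refine le_limsup_of_frequently_le ?_ (isBoundedUnder_stepProb_rpow S _)
  rw [frequently_atTop]
  intro N
  refine ⟨n * (N + 1), ?_, ?_⟩
  · nlinarith [Nat.pos_of_ne_zero hn]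
  · calc stepProb S n ({1} : Set Γ) ^ ((n : ℝ))⁻¹
        = (stepProb S n {1} ^ (N + 1)) ^ (((n * (N + 1) : ℕ) : ℝ))⁻¹ := by
          rw [← Real.rpow_natCast, ← Real.rpow_mul (stepProb_nonneg _ _ _)]
          congr 1
          have : (n : ℝ) ≠ 0 := by exact_mod_cast hn
          push_cast
          field_simp
      _ ≤ _ := Real.rpow_le_rpow (pow_nonneg (stepProb_nonneg _ _ _) _)
          (stepProb_one_pow_le S n (N + 1)) (by positivity)

lemma specRadius_nonneg (S : Finset Γ) : 0 ≤ specRadius S :=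
  (Real.rpow_nonneg (stepProb_nonneg _ _ _) _).trans
    (stepProb_one_rpow_le_specRadius S one_ne_zero)

lemma stepProb_one_le_pow (S : Finset Γ) (n : ℕ) :
    stepProb S n ({1} : Set Γ) ≤ specRadius S ^ n := by
  rcases eq_or_ne n 0 with rfl | hn
  · simp [stepProb_zero_one]
  · calc stepProb S n ({1} : Set Γ) = (stepProb S n {1} ^ ((n : ℝ))⁻¹) ^ n :=
          (Real.rpow_inv_natCast_pow (stepProb_nonneg _ _ _) hn).symm
      _ ≤ specRadius S ^ n :=
        pow_le_pow_left₀ (Real.rpow_nonneg (stepProb_nonneg _ _ _) _)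
          (stepProb_one_rpow_le_specRadius S hn) n

lemma stepProb_singleton_le_pow (S : Finset Γ) (hsym : ∀ s ∈ S, s⁻¹ ∈ S) (j : ℕ) (g : Γ) :
    stepProb S j {g} ≤ specRadius S ^ j := by
  refine le_of_sq_le_sq ?_ (pow_nonneg (specRadius_nonneg S) j)
  calc stepProb S j {g} ^ 2 ≤ stepProb S (j + j) {1} := stepProb_sq_le S hsym j g
    _ ≤ specRadius S ^ (j + j) := stepProb_one_le_pow S _
    _ = (specRadius S ^ j) ^ 2 := by rw [← pow_mul, mul_two]

lemma stepProb_le_card_mul (S : Finset Γ) (hsym : ∀ s ∈ S, s⁻¹ ∈ S) (j : ℕ) (K : Set Γ)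
    (F : Finset Γ) (hF : ∀ t ∈ words S j K, (List.ofFn t).prod ∈ F) :
    stepProb S j K ≤ F.card * specRadius S ^ j := by
  have hsub : words S j K ⊆ ⋃ g ∈ F, words S j {g} := by
    intro t ht
    simp only [Set.mem_iUnion]
    exact ⟨_, hF t ht, ht.1, rfl⟩
  have hcard : (words S j K).ncard ≤ ∑ g ∈ F, (words S j {g}).ncard :=
    (Set.ncard_le_ncard hsub
      (F.finite_toSet.biUnion fun g _ => words_finite S j {g})).trans
      (Finset.set_ncard_biUnion_le _ _)
  calc stepProb S j K ≤ ∑ g ∈ F, stepProb S j {g} := by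
        simp only [stepProb_eq]
        rw [← Finset.sum_div]
        gcongr
        exact_mod_cast hcard
    _ ≤ ∑ _g ∈ F, specRadius S ^ j :=
        Finset.sum_le_sum fun g _ => stepProb_singleton_le_pow S hsym j g
    _ = F.card * specRadius S ^ j := by simp

lemma limsup_stepProb_le_specRadius (S : Finset Γ) (K : Set Γ) (C : ℝ)
    (h : ∀ j : ℕ, 1 ≤ j → stepProb S j K ≤ C * j * specRadius S ^ j) :
    limsup (fun j : ℕ => stepProb S j K ^ ((j : ℝ))⁻¹) atTop ≤ specRadius S := by
  have hlim : Tendsto (fun j : ℕ => ((j : ℝ) ^ ((j : ℝ))⁻¹) ^ 2 * specRadius S) atTop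
      (𝓝 (specRadius S)) := by
    have h1 : Tendsto (fun j : ℕ => (j : ℝ) ^ ((j : ℝ))⁻¹) atTop (𝓝 1) := by
      simpa [Function.comp_def] using tendsto_rpow_div.comp tendsto_natCast_atTop_atTop
    simpa using (h1.pow 2).mul_const (specRadius S)
  rw [← hlim.limsup_eq]
  refine limsup_le_limsup ?_ (isCoboundedUnder_stepProb_rpow S K) hlim.isBoundedUnder_le
  filter_upwards [eventually_ge_atTop 1, eventually_ge_atTop ⌈C⌉₊] with j hj hjC
  have hρ := specRadius_nonneg S
  calc stepProb S j K ^ ((j : ℝ))⁻¹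
      ≤ ((j : ℝ) ^ 2 * specRadius S ^ j) ^ ((j : ℝ))⁻¹ := by
        refine Real.rpow_le_rpow (stepProb_nonneg _ _ _) ((h j hj).trans ?_) (by positivity)
        rw [sq]
        gcongr
        exact Nat.ceil_le.mp hjC
    _ = ((j : ℝ) ^ ((j : ℝ))⁻¹) ^ 2 * specRadius S := by
        rw [Real.mul_rpow (by positivity) (by positivity),
          Real.pow_rpow_inv_natCast hρ (by omega)]
        congr 1
        rw [← Real.rpow_natCast, ← Real.rpow_natCast, ← Real.rpow_mul (by positivity),
          ← Real.rpow_mul (by positivity), mul_comm]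

lemma wlen_prod_le (S : Finset Γ) {j : ℕ} (t : Fin j → Γ) (ht : ∀ i, t i ∈ S) :
    wlen (S : Set Γ) (List.ofFn t).prod ≤ j := by
  refine Nat.sInf_le ⟨List.ofFn t, ?_, List.length_ofFn, rfl⟩
  intro s hs
  obtain ⟨i, rfl⟩ := (List.mem_ofFn' _ _).mp hs
  exact ht i

lemma one_le_wlen (S : Finset Γ) (hsym : ∀ s ∈ S, s⁻¹ ∈ S)
    (hgen : Subgroup.closure (S : Set Γ) = ⊤) {g : Γ} (hg : g ≠ 1) :
    1 ≤ wlen (S : Set Γ) g := by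
  have hmem : g ∈ Submonoid.closure ((S : Set Γ) ∪ (S : Set Γ)⁻¹) := by
    rw [← Subgroup.closure_toSubmonoid, hgen]
    trivial
  obtain ⟨l, hl, hlg⟩ := Submonoid.exists_list_of_mem_closure hmem
  have hne : {n : ℕ | ∃ l : List Γ, (∀ s ∈ l, s ∈ (S : Set Γ)) ∧ l.length = n ∧
      l.prod = g}.Nonempty := by
    refine ⟨l.length, l, fun s hs => ?_, rfl, hlg⟩
    rcases hl s hs with h | h
    · exact h
    · simpa using hsym _ h
  by_contra! hlt
  obtain ⟨l', -, hlen, hprod⟩ := Nat.sInf_mem hne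
  have h0 : l' = [] := List.length_eq_zero_iff.mp (hlen.trans (Nat.lt_one_iff.mp hlt))
  exact hg (by rw [← hprod, h0, List.prod_nil])

lemma stepProb_zpowers_le_of_isOfFinOrder (S : Finset Γ) (hsym : ∀ s ∈ S, s⁻¹ ∈ S) {r : Γ}
    (hfin : IsOfFinOrder r) :
    ∃ C : ℝ, ∀ j : ℕ, 1 ≤ j →
      stepProb S j (Subgroup.zpowers r : Set Γ) ≤ C * j * specRadius S ^ j := by
  have hK : (Subgroup.zpowers r : Set Γ).Finite := finite_zpowers.mpr hfin
  refine ⟨hK.toFinset.card, fun j hj => ?_⟩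
  have hρ := specRadius_nonneg S
  have hj' : (1 : ℝ) ≤ j := by exact_mod_cast hj
  refine (stepProb_le_card_mul S hsym j _ hK.toFinset fun t ht => by simpa using ht.2).trans ?_
  gcongr
  exact le_mul_of_one_le_right (by positivity) hj'

lemma stepProb_zpowers_le_of_wlen (S : Finset Γ) (hsym : ∀ s ∈ S, s⁻¹ ∈ S)
    {r : Γ} (hr : 1 ≤ wlen (S : Set Γ) r) {c : ℝ} (hc : 0 < c)
    (hlen : ∀ k : ℤ,
      c * |(k : ℝ)| * (wlen (S : Set Γ) r : ℝ) ≤ (wlen (S : Set Γ) (r ^ k) : ℝ)) :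
    ∃ C : ℝ, ∀ j : ℕ, 1 ≤ j →
      stepProb S j (Subgroup.zpowers r : Set Γ) ≤ C * j * specRadius S ^ j := by
  classical
  refine ⟨2 / c + 1, fun j hj => ?_⟩
  have hρ := specRadius_nonneg S
  have hj' : (1 : ℝ) ≤ j := by exact_mod_cast hj
  set M : ℕ := ⌊(j : ℝ) / c⌋₊ with hM
  have hMle : (M : ℝ) ≤ j / c := Nat.floor_le (by positivity)
  refine (stepProb_le_card_mul S hsym j _
    ((Finset.Icc (-(M : ℤ)) M).image fun k => r ^ k) ?_).trans ?_
  · rintro t ⟨ht, k, hk⟩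
    refine Finset.mem_image.mpr ⟨k, ?_, hk⟩
    have h1 : (wlen (S : Set Γ) (r ^ k) : ℝ) ≤ j := by
      have hk' : r ^ k = (List.ofFn t).prod := hk
      rw [hk']
      exact_mod_cast wlen_prod_le S t ht
    have h2 : c * |(k : ℝ)| ≤ j := by
      refine le_trans ?_ ((hlen k).trans h1)
      exact le_mul_of_one_le_right (by positivity) (by exact_mod_cast hr)
    have h3 : (k.natAbs : ℝ) ≤ j / c := by
      rw [Nat.cast_natAbs, Int.cast_abs, le_div_iff₀ hc, mul_comm]
      exact h2
    have h4 : k.natAbs ≤ M := Nat.le_floor h3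
    rw [Finset.mem_Icc]
    omega
  · gcongr
    have hcard : (((Finset.Icc (-(M : ℤ)) M).image fun k => r ^ k).card : ℝ) ≤ 2 * M + 1 := by
      have h := Finset.card_image_le (s := Finset.Icc (-(M : ℤ)) M) (f := fun k => r ^ k)
      rw [Int.card_Icc] at h
      have h' : ((Finset.Icc (-(M : ℤ)) M).image fun k => r ^ k).card ≤ 2 * M + 1 := by omega
      exact_mod_cast h'
    calc _ ≤ 2 * (M : ℝ) + 1 := hcard
      _ ≤ 2 * (j / c) + j := by gcongr
      _ = (2 / c + 1) * j := by ring

/-- Let `Γ` be generated by the finite symmetric set `S ∌ 1`, with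
nonamenable Cayley graph (`ρ(H) < 1`).  Let `r ≠ 1` have either finite order, or
infinite order with `|r^k| ≥ c·|k|·|r|` for all `k ∈ ℤ` and some `c > 0`.  Then the
spectral radius `limsup_j q_j^{1/j}` of the coset walk equals `ρ(H)`. -/
theorem coset_walk_spectral_radius (S : Finset Γ)
    (hsym : ∀ s ∈ S, s⁻¹ ∈ S) (hone : (1 : Γ) ∉ S) (hSne : S.Nonempty)
    (hgen : Subgroup.closure (S : Set Γ) = ⊤)
    (hnonamen :
      Filter.limsup (fun j : ℕ => stepProb S j ({1} : Set Γ) ^ ((j : ℝ))⁻¹)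
        Filter.atTop < 1)
    (r : Γ) (hr : r ≠ 1)
    (hcase : IsOfFinOrder r ∨ (¬ IsOfFinOrder r ∧ ∃ c : ℝ, 0 < c ∧ ∀ k : ℤ,
      c * |(k : ℝ)| * (wlen (S : Set Γ) r : ℝ) ≤ (wlen (S : Set Γ) (r ^ k) : ℝ))) :
    Filter.limsup
        (fun j : ℕ => stepProb S j ((Subgroup.zpowers r : Subgroup Γ) : Set Γ) ^ ((j : ℝ))⁻¹)
        Filter.atTop
      = Filter.limsup (fun j : ℕ => stepProb S j ({1} : Set Γ) ^ ((j : ℝ))⁻¹)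
          Filter.atTop := by
  refine le_antisymm ?_ ?_
  · obtain ⟨C, hC⟩ : ∃ C : ℝ, ∀ j : ℕ, 1 ≤ j →
        stepProb S j (Subgroup.zpowers r : Set Γ) ≤ C * j * specRadius S ^ j := by
      rcases hcase with hfin | ⟨-, c, hc, hlen⟩
      · exact stepProb_zpowers_le_of_isOfFinOrder S hsym hfin
      · exact stepProb_zpowers_le_of_wlen S hsym (one_le_wlen S hsym hgen hr) hc hlen
    exact limsup_stepProb_le_specRadius S _ C hC
  · refine limsup_le_limsup (Eventually.of_forall fun j => ?_)
      (isCoboundedUnder_stepProb_rpow S _) (isBoundedUnder_stepProb_rpow S _)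
    exact Real.rpow_le_rpow (stepProb_nonneg _ _ _)
      (stepProb_mono S j (by simp [one_mem])) (by positivity)

end Spec
end
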